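/- arXiv:1503.00745 — 5 statements merged into one kernel-verified Lean document; each statement's English description precedes it below -/
import Mathlib

section
/- Canonical Ideal Decomposition: let (X,≤) be a well quasi order. Every downward-closed set D ⊆ X is the union of a unique finite family of pairwise incomparable (for set inclusion) ideals; i.e., there exists a finite set 𝕀 of ideals of X, pairwise incomparable for ⊆, with D = ⋃𝕀, and any finite set of pairwise ⊆-incomparable ideals whose union is D equals 𝕀. -/
/-- `D` is downward-closed for the quasi-order `le`. -/
def DownClosed {X : Type*} (le : X → X → Prop) (D : Set X) : Prop :=
  ∀ ⦃x y : X⦄, le x y → y ∈ D → x ∈ D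

/-- `U` is upward-closed for the quasi-order `le`. -/
def UpClosed {X : Type*} (le : X → X → Prop) (U : Set X) : Prop :=
  ∀ ⦃x y : X⦄, le x y → x ∈ U → y ∈ U

/-- `S` is directed for the quasi-order `le`. -/
def DirectedSet {X : Type*} (le : X → X → Prop) (S : Set X) : Prop :=
  ∀ x₁ ∈ S, ∀ x₂ ∈ S, ∃ x ∈ S, le x₁ x ∧ le x₂ x

/-- An ideal: a nonempty, downward-closed, directed subset. -/
def IsIdealSet {X : Type*} (le : X → X → Prop) (I : Set X) : Prop :=
  I.Nonempty ∧ DownClosed le I ∧ DirectedSet le I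

/-- Downward closure `↓S`. -/
def DownCl {X : Type*} (le : X → X → Prop) (S : Set X) : Set X :=
  {x | ∃ s ∈ S, le x s}

/-- Upward closure `↑S`. -/
def UpCl {X : Type*} (le : X → X → Prop) (S : Set X) : Set X :=
  {x | ∃ s ∈ S, le s x}

/-- A well quasi order: a reflexive transitive relation such that every infinite
sequence is good (some `f i ≤ f j` with `i < j`). -/
def IsWqo {X : Type*} (le : X → X → Prop) : Prop :=
  Reflexive le ∧ Transitive le ∧ ∀ f : ℕ → X, ∃ i j : ℕ, i < j ∧ le (f i) (f j)

section IdealDecomposition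

variable {X : Type*} {le : X → X → Prop}

/-- In a wqo, strict inclusion of downward-closed sets is well-founded. -/
theorem IsWqo.wellFounded_downClosed (hwqo : IsWqo le) :
    WellFounded fun D E : {D : Set X // DownClosed le D} => D < E := by
  rw [wellFounded_iff_isEmpty_descending_chain]
  refine ⟨fun ⟨f, hf⟩ => ?_⟩
  have hanti : Antitone f := antitone_nat_of_succ_le fun n => (hf n).le
  have hex : ∀ n, ∃ x, x ∈ (f n).1 ∧ x ∉ (f (n + 1)).1 := fun n =>
    Set.not_subset.mp (hf n).not_ge
  choose x hx hx' using hex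
  obtain ⟨i, j, hij, hle⟩ := hwqo.2.2 x
  exact hx' i (hanti (Nat.succ_le_of_lt hij) ((f j).2 hle (hx j)))

theorem DownClosed.sep_not_le (hwqo : IsWqo le) {D : Set X} (hD : DownClosed le D)
    (a : X) : DownClosed le {y ∈ D | ¬ le a y} :=
  fun _ _ hxy hy => ⟨hD hxy hy.1, fun hax => hy.2 (hwqo.2.1 hax hxy)⟩

/-- In a wqo, every downward-closed set is a finite union of ideals. -/
theorem DownClosed.exists_finite_sUnion_ideals (hwqo : IsWqo le) {D : Set X}
    (hD : DownClosed le D) :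
    ∃ F : Set (Set X), F.Finite ∧ (∀ I ∈ F, IsIdealSet le I) ∧ D = ⋃₀ F := by
  suffices h : ∀ E : {D : Set X // DownClosed le D},
      ∃ F : Set (Set X), F.Finite ∧ (∀ I ∈ F, IsIdealSet le I) ∧ E.1 = ⋃₀ F from h ⟨D, hD⟩
  intro E
  induction E using hwqo.wellFounded_downClosed.induction with
  | _ E ih =>
    obtain ⟨E, hE⟩ := E
    rcases E.eq_empty_or_nonempty with rfl | hne
    · exact ⟨∅, Set.finite_empty, by simp, by simp⟩
    by_cases hdir : DirectedSet le E
    · exact ⟨{E}, Set.finite_singleton E, by simpa using ⟨hne, hE, hdir⟩, by simp⟩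
    · simp only [DirectedSet, not_forall, not_exists, not_and] at hdir
      obtain ⟨a, ha, b, hb, hab⟩ := hdir
      have hlt : ∀ c ∈ E, {y ∈ E | ¬ le c y} ⊂ E := fun c hc =>
        ⟨Set.sep_subset _ _, fun h => (h hc).2 (hwqo.1 c)⟩
      obtain ⟨F, hFfin, hF, hFE⟩ := ih ⟨_, hE.sep_not_le hwqo a⟩ (hlt a ha)
      obtain ⟨G, hGfin, hG, hGE⟩ := ih ⟨_, hE.sep_not_le hwqo b⟩ (hlt b hb)
      refine ⟨F ∪ G, hFfin.union hGfin, fun I hI => hI.elim (hF I) (hG I), ?_⟩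
      rw [Set.sUnion_union, ← hFE, ← hGE]
      ext y
      have := hab y
      simp only [Set.mem_union, Set.mem_sep_iff]
      tauto

/-- A nonempty directed set covered by finitely many downward-closed sets lies in one of them. -/
theorem DirectedSet.exists_subset_of_subset_sUnion {I : Set X} (hne : I.Nonempty)
    (hdir : DirectedSet le I) {F : Set (Set X)} (hfin : F.Finite)
    (hF : ∀ J ∈ F, DownClosed le J) (hIF : I ⊆ ⋃₀ F) : ∃ J ∈ F, I ⊆ J := by
  induction F, hfin using Set.Finite.induction_on with
  | empty =>
    obtain ⟨x, hx⟩ := hne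
    simpa using hIF hx
  | @insert A F _ _ ih =>
    by_cases hIA : I ⊆ A
    · exact ⟨A, Set.mem_insert _ _, hIA⟩
    obtain ⟨x, hx, hxA⟩ := Set.not_subset.mp hIA
    obtain ⟨J, hJ, hIJ⟩ := ih (fun J hJ => hF J (Set.mem_insert_of_mem _ hJ)) fun y hy => by
      obtain ⟨z, hz, hxz, hyz⟩ := hdir x hx y hy
      obtain ⟨K, rfl | hK, hzK⟩ := hIF hz
      · exact absurd (hF _ (Set.mem_insert _ _) hxz hzK) hxA
      · exact ⟨K, hK, hF K (Set.mem_insert_of_mem _ hK) hyz hzK⟩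
    exact ⟨J, Set.mem_insert_of_mem _ hJ, hIJ⟩

/-- A finite family of pairwise incomparable ideals is contained in any finite family of ideals
with the same union. -/
theorem subset_of_sUnion_eq_of_pairwise_incomparable {F G : Set (Set X)}
    (hFfin : F.Finite) (hF : ∀ I ∈ F, IsIdealSet le I)
    (hFinc : F.Pairwise fun I J => ¬ I ⊆ J ∧ ¬ J ⊆ I)
    (hGfin : G.Finite) (hG : ∀ I ∈ G, IsIdealSet le I) (hFG : ⋃₀ F = ⋃₀ G) : F ⊆ G := by
  intro I hI
  obtain ⟨J, hJ, hIJ⟩ := (hF I hI).2.2.exists_subset_of_subset_sUnion (hF I hI).1 hGfin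
    (fun J hJ => (hG J hJ).2.1) (hFG ▸ Set.subset_sUnion_of_mem hI)
  obtain ⟨K, hK, hJK⟩ := (hG J hJ).2.2.exists_subset_of_subset_sUnion (hG J hJ).1 hFfin
    (fun K hK => (hF K hK).2.1) (hFG ▸ Set.subset_sUnion_of_mem hJ)
  have hIK : I = K := hFinc.eq hI hK fun h => h.1 (hIJ.trans hJK)
  have hIJ' : I = J := hIJ.antisymm (hIK ▸ hJK)
  exact hIJ' ▸ hJ

end IdealDecomposition

/-- Canonical Ideal Decomposition: in a wqo, every downward-closed set is the
union of a unique finite family of pairwise ⊆-incomparable ideals. -/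
theorem canonical_ideal_decomposition {X : Type*} (le : X → X → Prop)
    (hwqo : IsWqo le) (D : Set X) (hD : DownClosed le D) :
    ∃! 𝕀 : Set (Set X), 𝕀.Finite ∧ (∀ I ∈ 𝕀, IsIdealSet le I) ∧
      (𝕀.Pairwise fun I J => ¬ I ⊆ J ∧ ¬ J ⊆ I) ∧ D = ⋃₀ 𝕀 := by
  refine existsUnique_of_exists_of_unique ?_ ?_
  · obtain ⟨F, hfin, hF, hDF⟩ := hD.exists_finite_sUnion_ideals hwqo
    have hsub : {I | Maximal (· ∈ F) I} ⊆ F := fun I hI => hI.prop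
    refine ⟨{I | Maximal (· ∈ F) I}, hfin.subset hsub, fun I hI => hF I (hsub hI), ?_, ?_⟩
    · intro I hI J hJ hne
      exact ⟨fun h => hne (hI.eq_of_subset hJ.prop h),
        fun h => hne (hJ.eq_of_subset hI.prop h).symm⟩
    · rw [hDF]
      refine Set.Subset.antisymm ?_ (Set.sUnion_subset_sUnion hsub)
      rintro x ⟨I, hI, hx⟩
      obtain ⟨J, hIJ, hJ⟩ := hfin.exists_le_maximal hI
      exact ⟨J, hJ, hIJ hx⟩
  · rintro F G ⟨hFfin, hF, hFinc, hDF⟩ ⟨hGfin, hG, hGinc, hDG⟩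
    exact Set.Subset.antisymm
      (subset_of_sUnion_eq_of_pairwise_incomparable hFfin hF hFinc hGfin hG (hDF ▸ hDG))
      (subset_of_sUnion_eq_of_pairwise_incomparable hGfin hG hGinc hFfin hF (hDG ▸ hDF))
end

section
/- Let (X,≤) be a well quasi order. The ideals of (X*, ≤*), the set of finite sequences over X ordered by sequence embedding, are exactly the products over X. -/
/-- Sequence embedding between finite sequences over `(X, le)`. -/
inductive SeqEmb {X : Type*} (le : X → X → Prop) : List X → List X → Prop
  | nil : ∀ l : List X, SeqEmb le [] l
  | cons : ∀ {x y : X} {l l' : List X}, le x y → SeqEmb le l l' →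
      SeqEmb le (x :: l) (y :: l')
  | skip : ∀ {y : X} {l l' : List X}, SeqEmb le l l' → SeqEmb le l (y :: l')

/-- An atom over `X`: either `D*` for a downward-closed `D ⊆ X`, or
`I ∪ {ε}` for an ideal `I` of `X` (one-letter sequences with letter in `I`,
plus the empty sequence). -/
def IsAtomLang {X : Type*} (le : X → X → Prop) (A : Set (List X)) : Prop :=
  (∃ D : Set X, DownClosed le D ∧ A = {w : List X | ∀ x ∈ w, x ∈ D}) ∨
  (∃ I : Set X, IsIdealSet le I ∧ A = {w : List X | w = [] ∨ ∃ x ∈ I, w = [x]})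

/-- The concatenation of a finite list of languages: all sequences
`w₁ ++ ⋯ ++ w_k` with `w_j ∈ A_j`. -/
def ConcatLang {X : Type*} (As : List (Set (List X))) : Set (List X) :=
  {w : List X | ∃ ws : List (List X), List.Forall₂ (· ∈ ·) ws As ∧ w = ws.flatten}

/-- A product over `X`: a concatenation `A₁ ⋯ A_k` of finitely many atoms. -/
def IsProductLang {X : Type*} (le : X → X → Prop) (P : Set (List X)) : Prop :=
  ∃ As : List (Set (List X)), (∀ A ∈ As, IsAtomLang le A) ∧ P = ConcatLang As

section SequenceEmbedding

variable {X : Type*} {le : X → X → Prop}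

theorem SeqEmb.iff_sublistForall₂ {l l' : List X} :
    SeqEmb le l l' ↔ List.SublistForall₂ le l l' := by
  constructor
  · intro h
    induction h with
    | nil l => exact .nil
    | cons hxy _ ih => exact .cons hxy ih
    | skip _ ih => exact .cons_right ih
  · intro h
    induction h with
    | nil => exact .nil _
    | cons hxy _ ih => exact .cons hxy ih
    | cons_right _ ih => exact .skip ih

theorem SeqEmb.refl (hr : ∀ x, le x x) (l : List X) : SeqEmb le l l := by
  induction l with
  | nil => exact .nil _
  | cons x l ih => exact .cons (hr x) ih

theorem SeqEmb.append {u u' v v' : List X} (hu : SeqEmb le u u') (hv : SeqEmb le v v') :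
    SeqEmb le (u ++ v) (u' ++ v') := by
  induction hu with
  | nil l =>
    induction l with
    | nil => exact hv
    | cons x l ih => exact .skip ih
  | cons hxy _ ih => exact .cons hxy ih
  | skip _ ih => exact .skip ih

theorem SeqEmb.exists_of_append_right {w u v : List X} (h : SeqEmb le w (u ++ v)) :
    ∃ w₁ w₂, w = w₁ ++ w₂ ∧ SeqEmb le w₁ u ∧ SeqEmb le w₂ v := by
  induction u generalizing w with
  | nil => exact ⟨[], w, rfl, .nil _, h⟩
  | cons y u ih =>
    cases h with
    | nil => exact ⟨[], [], rfl, .nil _, .nil _⟩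
    | cons hxy h =>
      obtain ⟨w₁, w₂, rfl, h₁, h₂⟩ := ih h
      exact ⟨_ :: w₁, w₂, rfl, .cons hxy h₁, h₂⟩
    | skip h =>
      obtain ⟨w₁, w₂, rfl, h₁, h₂⟩ := ih h
      exact ⟨w₁, w₂, rfl, .skip h₁, h₂⟩

theorem SeqEmb.exists_of_mem {l l' : List X} (h : SeqEmb le l l') :
    ∀ x ∈ l, ∃ y ∈ l', le x y := by
  induction h with
  | nil l => simp
  | cons hxy _ ih =>
    intro x hx
    rcases List.mem_cons.1 hx with rfl | hx
    · exact ⟨_, List.mem_cons_self, hxy⟩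
    · obtain ⟨y, hy, h⟩ := ih x hx
      exact ⟨y, List.mem_cons_of_mem _ hy, h⟩
  | skip _ ih =>
    intro x hx
    obtain ⟨y, hy, h⟩ := ih x hx
    exact ⟨y, List.mem_cons_of_mem _ hy, h⟩

/-- **Higman's lemma** for `SeqEmb`. -/
theorem IsWqo.wellQuasiOrdered_seqEmb (h : IsWqo le) : WellQuasiOrdered (SeqEmb le) := by
  have : IsPreorder X le := { refl := h.1, trans := fun _ _ _ => @h.2.1 _ _ _ }
  have hp : (Set.univ : Set X).PartiallyWellOrderedOn le :=
    Set.partiallyWellOrderedOn_univ_iff.2 h.2.2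
  intro f
  obtain ⟨m, n, hmn, hle⟩ :=
    (Set.PartiallyWellOrderedOn.partiallyWellOrderedOn_sublistForall₂ le hp).exists_lt
      (f := f) (by simp)
  exact ⟨m, n, hmn, SeqEmb.iff_sublistForall₂.2 hle⟩

end SequenceEmbedding

section Ideals

variable {X Y : Type*} {le : X → X → Prop}

theorem DownClosed.induction (hw : WellQuasiOrdered le) {C : Set X → Prop}
    (step : ∀ D, DownClosed le D → (∀ E, DownClosed le E → E ⊂ D → C E) → C D)
    (D : Set X) (hD : DownClosed le D) : C D := by
  have wf : WellFounded fun E D : {D : Set X // DownClosed le D} => E.1 ⊂ D.1 := by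
    rw [wellFounded_iff_isEmpty_descending_chain]
    refine ⟨fun ⟨f, hf⟩ => ?_⟩
    choose w hw₁ hw₂ using fun n => Set.exists_of_ssubset (hf n)
    obtain ⟨m, n, hmn, hle⟩ := hw w
    have hanti : Antitone fun n => (f n).1 := antitone_nat_of_succ_le fun n => (hf n).subset
    exact hw₂ m ((f (m + 1)).2 hle (hanti hmn (hw₁ n)))
  exact wf.induction (C := fun D => C D.1) ⟨D, hD⟩
    fun D ih => step D.1 D.2 fun E hE hED => ih ⟨E, hE⟩ hED

theorem DownClosed.exists_finite_ideals (hr : ∀ x, le x x) (ht : ∀ {x y z}, le x y → le y z → le x z)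
    (hw : WellQuasiOrdered le) {D : Set X} (hD : DownClosed le D) :
    ∃ 𝒮 : Set (Set X), 𝒮.Finite ∧ (∀ S ∈ 𝒮, IsIdealSet le S) ∧ D = ⋃₀ 𝒮 := by
  refine DownClosed.induction hw
    (C := fun D => ∃ 𝒮 : Set (Set X), 𝒮.Finite ∧ (∀ S ∈ 𝒮, IsIdealSet le S) ∧ D = ⋃₀ 𝒮)
    (fun D hD ih => ?_) D hD
  rcases D.eq_empty_or_nonempty with rfl | hne
  · exact ⟨∅, Set.finite_empty, by simp, by simp⟩
  by_cases hdir : DirectedSet le D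
  · exact ⟨{D}, Set.finite_singleton D, by simpa using ⟨hne, hD, hdir⟩, by simp⟩
  simp only [DirectedSet, not_forall] at hdir
  obtain ⟨x, hx, y, hy, hxy⟩ := hdir
  have key : ∀ z ∈ D, ∃ 𝒮 : Set (Set X), 𝒮.Finite ∧ (∀ S ∈ 𝒮, IsIdealSet le S) ∧
      {t ∈ D | ¬ le z t} = ⋃₀ 𝒮 := fun z hz =>
    ih _ (fun s t hst ht' => ⟨hD hst ht'.1, fun h => ht'.2 (ht h hst)⟩)
      ⟨fun t h => h.1, fun h => (h hz).2 (hr z)⟩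
  obtain ⟨𝒮, hf, hi, h𝒮⟩ := key x hx
  obtain ⟨𝒯, hf', hi', h𝒯⟩ := key y hy
  refine ⟨𝒮 ∪ 𝒯, hf.union hf', fun S hS => hS.elim (hi S) (hi' S), ?_⟩
  rw [Set.sUnion_union, ← h𝒮, ← h𝒯]
  ext t
  constructor
  · intro ht
    by_cases h : le x t
    · exact .inr ⟨ht, fun h' => hxy ⟨t, ht, h, h'⟩⟩
    · exact .inl ⟨ht, h⟩
  · exact fun h => h.elim (·.1) (·.1)

theorem DirectedSet.exists_subset_of_subset_sUnion_s8 {P : Set X} (hP : DirectedSet le P)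
    (hne : P.Nonempty) {𝒮 : Set (Set X)} (hfin : 𝒮.Finite)
    (hdown : ∀ S ∈ 𝒮, DownClosed le S) (hsub : P ⊆ ⋃₀ 𝒮) : ∃ S ∈ 𝒮, P ⊆ S := by
  induction 𝒮, hfin using Set.Finite.induction_on with
  | empty => exact absurd (hsub hne.choose_spec) (by simp)
  | @insert A 𝒮 _ _ ih =>
    by_cases hA : P ⊆ A
    · exact ⟨A, Set.mem_insert _ _, hA⟩
    obtain ⟨p, hp, hpA⟩ := Set.not_subset.1 hA
    obtain ⟨S, hS, hPS⟩ := ih (fun S hS => hdown S (Set.mem_insert_of_mem _ hS)) (by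
      intro q hq
      obtain ⟨r, hr, hpr, hqr⟩ := hP p hp q hq
      obtain ⟨S, rfl | hS, hrS⟩ := hsub hr
      · exact absurd (hdown _ (Set.mem_insert _ _) hpr hrS) hpA
      · exact ⟨S, hS, hdown S (Set.mem_insert_of_mem _ hS) hqr hrS⟩)
    exact ⟨S, Set.mem_insert_of_mem _ hS, hPS⟩

variable {le' : Y → Y → Prop} {Q : Set (X × Y)}

theorem IsIdealSet.mk_mem_of_prod
    (hQ : IsIdealSet (fun p q : X × Y => le p.1 q.1 ∧ le' p.2 q.2) Q) {p q : X × Y}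
    (hp : p ∈ Q) (hq : q ∈ Q) : (p.1, q.2) ∈ Q := by
  obtain ⟨r, hr, hpr, hqr⟩ := hQ.2.2 p hp q hq
  exact hQ.2.1 (x := (p.1, q.2)) ⟨hpr.1, hqr.2⟩ hr

theorem IsIdealSet.image_fst (hr : ∀ y, le' y y)
    (hQ : IsIdealSet (fun p q : X × Y => le p.1 q.1 ∧ le' p.2 q.2) Q) :
    IsIdealSet le (Prod.fst '' Q) := by
  refine ⟨hQ.1.image _, ?_, ?_⟩
  · rintro x _ hx ⟨q, hq, rfl⟩
    exact ⟨(x, q.2), hQ.2.1 (x := (x, q.2)) ⟨hx, hr _⟩ hq, rfl⟩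
  · rintro _ ⟨p, hp, rfl⟩ _ ⟨q, hq, rfl⟩
    obtain ⟨r, hr, hpr, hqr⟩ := hQ.2.2 p hp q hq
    exact ⟨r.1, ⟨r, hr, rfl⟩, hpr.1, hqr.1⟩

theorem IsIdealSet.image_snd (hr : ∀ x, le x x)
    (hQ : IsIdealSet (fun p q : X × Y => le p.1 q.1 ∧ le' p.2 q.2) Q) :
    IsIdealSet le' (Prod.snd '' Q) := by
  refine ⟨hQ.1.image _, ?_, ?_⟩
  · rintro y _ hy ⟨q, hq, rfl⟩
    exact ⟨(q.1, y), hQ.2.1 (x := (q.1, y)) (y := q) ⟨hr _, hy⟩ hq, rfl⟩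
  · rintro _ ⟨p, hp, rfl⟩ _ ⟨q, hq, rfl⟩
    obtain ⟨r, hr, hpr, hqr⟩ := hQ.2.2 p hp q hq
    exact ⟨r.2, ⟨r, hr, rfl⟩, hpr.2, hqr.2⟩

end Ideals

section Products

variable {X : Type*} {le : X → X → Prop}

theorem ConcatLang.mem_nil {w : List X} : w ∈ ConcatLang [] ↔ w = [] := by
  simp [ConcatLang]

theorem ConcatLang.mem_cons {A : Set (List X)} {As : List (Set (List X))} {w : List X} :
    w ∈ ConcatLang (A :: As) ↔ ∃ u ∈ A, ∃ v ∈ ConcatLang As, w = u ++ v := by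
  constructor
  · rintro ⟨_, h, rfl⟩
    cases h with
    | cons hu hv => exact ⟨_, hu, _, ⟨_, hv, rfl⟩, by simp⟩
  · rintro ⟨u, hu, _, ⟨ws, hws, rfl⟩, rfl⟩
    exact ⟨u :: ws, .cons hu hws, by simp⟩

theorem ConcatLang.mem_triple {A B K : Set (List X)} {w : List X} :
    w ∈ ConcatLang [A, B, K] ↔ ∃ u ∈ A, ∃ b ∈ B, ∃ v ∈ K, w = u ++ (b ++ v) := by
  simp only [ConcatLang.mem_cons, ConcatLang.mem_nil]
  grind

theorem ConcatLang.isIdealSet {As : List (Set (List X))}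
    (h : ∀ A ∈ As, IsIdealSet (SeqEmb le) A) : IsIdealSet (SeqEmb le) (ConcatLang As) := by
  induction As with
  | nil =>
    refine ⟨⟨[], ConcatLang.mem_nil.2 rfl⟩, fun x y hxy hy => ?_, fun x hx y hy => ?_⟩
    · rw [ConcatLang.mem_nil] at hy ⊢
      subst hy
      cases hxy
      rfl
    · rw [ConcatLang.mem_nil] at hx hy
      subst hx hy
      exact ⟨[], ConcatLang.mem_nil.2 rfl, .nil _, .nil _⟩
  | cons A As ih =>
    obtain ⟨⟨a, ha⟩, hAdown, hAdir⟩ := h A List.mem_cons_self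
    obtain ⟨⟨b, hb⟩, hdown, hdir⟩ := ih fun B hB => h B (List.mem_cons_of_mem _ hB)
    refine ⟨⟨a ++ b, ConcatLang.mem_cons.2 ⟨a, ha, b, hb, rfl⟩⟩, fun x y hxy hy => ?_,
      fun x hx y hy => ?_⟩
    · obtain ⟨u, hu, v, hv, rfl⟩ := ConcatLang.mem_cons.1 hy
      obtain ⟨x₁, x₂, rfl, h₁, h₂⟩ := hxy.exists_of_append_right
      exact ConcatLang.mem_cons.2 ⟨x₁, hAdown h₁ hu, x₂, hdown h₂ hv, rfl⟩
    · obtain ⟨u, hu, v, hv, rfl⟩ := ConcatLang.mem_cons.1 hx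
      obtain ⟨u', hu', v', hv', rfl⟩ := ConcatLang.mem_cons.1 hy
      obtain ⟨s, hs, hus, hus'⟩ := hAdir u hu u' hu'
      obtain ⟨t, ht, hvt, hvt'⟩ := hdir v hv v' hv'
      exact ⟨s ++ t, ConcatLang.mem_cons.2 ⟨s, hs, t, ht, rfl⟩, hus.append hvt,
        hus'.append hvt'⟩

theorem IsAtomLang.isIdealSet (hr : ∀ x, le x x) {A : Set (List X)} (hA : IsAtomLang le A) :
    IsIdealSet (SeqEmb le) A := by
  rcases hA with ⟨D, hD, rfl⟩ | ⟨I, ⟨⟨a, ha⟩, hdown, hdir⟩, rfl⟩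
  · refine ⟨⟨[], by simp⟩, fun u v huv hv x hx => ?_, fun u hu v hv => ?_⟩
    · obtain ⟨y, hy, hxy⟩ := huv.exists_of_mem x hx
      exact hD hxy (hv y hy)
    · refine ⟨u ++ v, fun x hx => (List.mem_append.1 hx).elim (hu x) (hv x), ?_, ?_⟩
      · simpa using (SeqEmb.refl hr u).append (.nil v)
      · simpa using (SeqEmb.nil u).append (.refl hr v)
  · refine ⟨⟨[], .inl rfl⟩, ?_, ?_⟩
    · rintro u _ huv (rfl | ⟨y, hy, rfl⟩)
      · cases huv
        exact .inl rfl
      · cases huv with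
        | nil => exact .inl rfl
        | cons hxy h =>
          cases h
          exact .inr ⟨_, hdown hxy hy, rfl⟩
        | skip h =>
          cases h
          exact .inl rfl
    · rintro _ (rfl | ⟨x, hx, rfl⟩) _ (rfl | ⟨y, hy, rfl⟩)
      · exact ⟨[], .inl rfl, .nil _, .nil _⟩
      · exact ⟨[y], .inr ⟨y, hy, rfl⟩, .nil _, .refl hr _⟩
      · exact ⟨[x], .inr ⟨x, hx, rfl⟩, .refl hr _, .nil _⟩
      · obtain ⟨z, hz, hxz, hyz⟩ := hdir x hx y hy
        exact ⟨[z], .inr ⟨z, hz, rfl⟩, .cons hxz (.nil _), .cons hyz (.nil _)⟩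

theorem IsProductLang.isIdealSet (hr : ∀ x, le x x) {P : Set (List X)}
    (hP : IsProductLang le P) : IsIdealSet (SeqEmb le) P := by
  obtain ⟨As, hAs, rfl⟩ := hP
  exact ConcatLang.isIdealSet fun A hA => (hAs A hA).isIdealSet hr

theorem IsProductLang.triple {A B K : Set (List X)} (hA : IsAtomLang le A)
    (hB : IsAtomLang le B) (hK : IsProductLang le K) :
    IsProductLang le (ConcatLang [A, B, K]) := by
  obtain ⟨As, hAs, rfl⟩ := hK
  refine ⟨A :: B :: As, by simp_all, ?_⟩
  ext w
  simp only [ConcatLang.mem_cons, ConcatLang.mem_nil]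
  grind

/-- Peel off the letters that can be prepended to every word of the ideal: what follows the first
other letter ranges over ideals that are strictly smaller. -/
theorem IsIdealSet.isProductLang (hwqo : IsWqo le) {P : Set (List X)}
    (hP : IsIdealSet (SeqEmb le) P) : IsProductLang le P := by
  have hr : ∀ x, le x x := hwqo.1
  have hrs : ∀ l, SeqEmb le l l := SeqEmb.refl hr
  have ht : ∀ {x y z}, le x y → le y z → le x z := fun h h' => hwqo.2.1 h h'
  have : IsPreorder X le := { refl := hr, trans := fun _ _ _ => ht }
  have hts : ∀ {u v w}, SeqEmb le u v → SeqEmb le v w → SeqEmb le u w := fun h h' => by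
    rw [SeqEmb.iff_sublistForall₂] at *
    exact _root_.trans h h'
  have hw := hwqo.wellQuasiOrdered_seqEmb
  refine DownClosed.induction hw (C := fun P => IsIdealSet (SeqEmb le) P → IsProductLang le P)
    (fun P hdown ih hP => ?_) P hP.2.1 hP
  let D : Set X := {x | ∀ w ∈ P, x :: w ∈ P}
  have hD : DownClosed le D := fun x y hxy hy w hw => hdown (.cons hxy (hrs w)) (hy w hw)
  let star : Set (List X) := {w | ∀ x ∈ w, x ∈ D}
  have hstar : IsAtomLang le star := .inl ⟨D, hD, rfl⟩
  have hnil : [] ∈ P := hdown (.nil _) hP.1.choose_spec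
  have happend : ∀ u ∈ star, ∀ v ∈ P, u ++ v ∈ P := by
    intro u hu v hv
    induction u with
    | nil => exact hv
    | cons x u ihu =>
      exact hu x List.mem_cons_self _ (ihu fun y hy => hu y (List.mem_cons_of_mem _ hy))
  let leProd : X × List X → X × List X → Prop := fun p q => le p.1 q.1 ∧ SeqEmb le p.2 q.2
  have hM : DownClosed leProd {p | p.1 :: p.2 ∈ P} := fun p q hpq hq =>
    hdown (.cons hpq.1 hpq.2) hq
  obtain ⟨𝒮, hfin, hideal, hcover⟩ := hM.exists_finite_ideals (fun p => ⟨hr _, hrs _⟩)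
    (fun h h' => ⟨ht h.1 h'.1, hts h.2 h'.2⟩)
    (WellQuasiOrdered.prod hwqo.2.2 hw)
  let letter (Q : Set (X × List X)) : Set (List X) :=
    {w | w = [] ∨ ∃ x ∈ Prod.fst '' Q, w = [x]}
  have hletter : ∀ Q ∈ 𝒮, IsAtomLang le (letter Q) := fun Q hQ =>
    .inr ⟨_, (hideal Q hQ).image_fst hrs, rfl⟩
  let piece (Q : Set (X × List X)) : Set (List X) := ConcatLang [star, letter Q, Prod.snd '' Q]
  have hpiece : ∀ Q ∈ 𝒮, DownClosed (SeqEmb le) (piece Q) := fun Q hQ =>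
    (ConcatLang.isIdealSet (by
      simp only [List.forall_mem_cons]
      exact ⟨hstar.isIdealSet hr, (hletter Q hQ).isIdealSet hr, (hideal Q hQ).image_snd hr,
        by simp⟩)).2.1
  let 𝒯 : Set (Set (List X)) := insert star (piece '' {Q ∈ 𝒮 | ¬ Prod.fst '' Q ⊆ D})
  have hsub : P ⊆ ⋃₀ 𝒯 := by
    intro w hw
    induction w with
    | nil => exact ⟨star, Set.mem_insert _ _, by simp [star]⟩
    | cons x v ihv =>
      by_cases hx : x ∈ D
      · obtain ⟨T, hT, hvT⟩ := ihv (hdown (.skip (hrs v)) hw)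
        refine ⟨T, hT, ?_⟩
        rcases hT with rfl | ⟨Q, -, rfl⟩
        · exact List.forall_mem_cons.2 ⟨hx, hvT⟩
        · obtain ⟨u, hu, b, hb, k, hk, rfl⟩ := ConcatLang.mem_triple.1 hvT
          exact ConcatLang.mem_triple.2
            ⟨x :: u, List.forall_mem_cons.2 ⟨hx, hu⟩, b, hb, k, hk, rfl⟩
      · obtain ⟨Q, hQ, hxQ⟩ : (x, v) ∈ ⋃₀ 𝒮 := hcover ▸ hw
        refine ⟨piece Q, .inr ⟨Q, ⟨hQ, fun h => hx (h ⟨_, hxQ, rfl⟩)⟩, rfl⟩, ?_⟩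
        exact ConcatLang.mem_triple.2
          ⟨[], by simp [star], [x], .inr ⟨x, ⟨_, hxQ, rfl⟩, rfl⟩, v, ⟨_, hxQ, rfl⟩, rfl⟩
  obtain ⟨T, hT, hPT⟩ := hP.2.2.exists_subset_of_subset_sUnion_s8 hP.1
    (((hfin.subset fun Q hQ => hQ.1).image piece).insert star)
    (by
      rintro T (rfl | ⟨Q, hQ, rfl⟩)
      · exact (hstar.isIdealSet hr).2.1
      · exact hpiece Q hQ.1) hsub
  rcases hT with rfl | ⟨Q, ⟨hQ, hQD⟩, rfl⟩
  · have hPeq : P = ConcatLang [star] := by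
      ext w
      simp only [ConcatLang.mem_cons, ConcatLang.mem_nil]
      exact ⟨fun h => ⟨w, hPT h, [], rfl, by simp⟩, by
        rintro ⟨u, hu, _, rfl, rfl⟩
        exact happend u hu _ hnil⟩
    exact ⟨[star], by simpa using hstar, hPeq⟩
  · have hQP : ∀ p ∈ Q, p.1 :: p.2 ∈ P := fun p hp => by
      have : p ∈ {p : X × List X | p.1 :: p.2 ∈ P} := hcover ▸ ⟨Q, hQ, hp⟩
      exact this
    have hKP : Prod.snd '' Q ⊆ P := by
      rintro _ ⟨p, hp, rfl⟩
      exact hdown (.skip (hrs _)) (hQP p hp)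
    have hK := (hideal Q hQ).image_snd hr
    have hK_ssub : Prod.snd '' Q ⊂ P := by
      refine ⟨hKP, fun hPK => hQD ?_⟩
      rintro _ ⟨p, hp, rfl⟩ w hw
      obtain ⟨q, hq, rfl⟩ := hPK hw
      exact hQP _ ((hideal Q hQ).mk_mem_of_prod hp hq)
    have hPeq : P = piece Q := by
      refine hPT.antisymm fun w hw => ?_
      obtain ⟨u, hu, b, hb, _, ⟨q, hq, rfl⟩, rfl⟩ := ConcatLang.mem_triple.1 hw
      refine happend u hu _ ?_
      rcases hb with rfl | ⟨_, ⟨p, hp, rfl⟩, rfl⟩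
      · exact hKP ⟨q, hq, rfl⟩
      · exact hQP _ ((hideal Q hQ).mk_mem_of_prod hp hq)
    rw [hPeq]
    exact .triple hstar (hletter Q hQ) (ih _ hK.2.1 hK_ssub hK)

end Products

/-- The ideals of `(X*, ≤*)`, finite sequences over a wqo `(X, le)` ordered by
sequence embedding, are exactly the products over `X`. -/
theorem ideals_of_sequences_are_products {X : Type*} (le : X → X → Prop)
    (hwqo : IsWqo le) (P : Set (List X)) :
    IsIdealSet (SeqEmb le) P ↔ IsProductLang le P :=
  ⟨fun h => h.isProductLang hwqo, fun h => h.isIdealSet hwqo.1⟩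
end

section
/- The transition ideals of ℕ^d × A × ℕ^d are exactly the sets ↓t with t a partial transition. -/
/-- Configurations of a `d`-dimensional VAS: vectors in `ℕ^d`. -/
abbrev Conf (d : ℕ) := Fin d → ℕ

/-- Actions: vectors in `ℤ^d`. -/
abbrev Act (d : ℕ) := Fin d → ℤ

/-- Triples in `ℕ^d × ℤ^d × ℕ^d` (potential transitions). -/
abbrev Trip (d : ℕ) := Conf d × Act d × Conf d

/-- Preruns: a source, a word of triples, and a target. -/
abbrev PreRun (d : ℕ) := Conf d × List (Trip d) × Conf d

/-- A transition of the VAS `A`: a triple `(u, a, v)` with `a ∈ A` and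
`v = u + a`. -/
def IsTransition {d : ℕ} (A : Set (Act d)) (t : Trip d) : Prop :=
  t.2.1 ∈ A ∧ ∀ i, (t.2.2 i : ℤ) = (t.1 i : ℤ) + t.2.1 i

/-- `ChainFrom x w y` holds when the word `w` of triples chains from `x` to
`y`: either `w` is empty and `x = y`, or the first source is `x`, the last
target is `y`, and the target of each triple is the source of the next one. -/
def ChainFrom {d : ℕ} : Conf d → List (Trip d) → Conf d → Prop
  | x, [], y => x = y
  | x, t :: w, y => t.1 = x ∧ ChainFrom t.2.2 w y

/-- A run of the VAS `A`: a prerun whose triples are transitions of `A`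
chaining from its source to its target. -/
def IsRun {d : ℕ} (A : Set (Act d)) (ρ : PreRun d) : Prop :=
  (∀ t ∈ ρ.2.1, IsTransition A t) ∧ ChainFrom ρ.1 ρ.2.1 ρ.2.2

/-- Partial configurations: vectors in `ℕ_ω^d 
  (`ℕ_ω = ℕ ∪ {ω}`, represented by `ℕ∞`, with `ω = ⊤`). -/
abbrev PConf (d : ℕ) := Fin d → ℕ∞

/-- Embedding of configurations into partial configurations. -/
def toPC {d : ℕ} (q : Conf d) : PConf d := fun i => (q i : ℕ∞)

open scoped Classical in
/-- The projection `π_F`: keeps the coordinates in `F` and sets the others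
to `ω`. -/
noncomputable def projPC {d : ℕ} (F : Set (Fin d)) (u : PConf d) : PConf d :=
  fun i => if i ∈ F then u i else ⊤

/-- The finite (defined) coordinates of a partial configuration. -/
def FinCoords {d : ℕ} (u : PConf d) : Set (Fin d) := {i | u i ≠ ⊤}

/-- A partial transition: a triple `(u, a, v)` in `ℕ_ω^d × A × ℕ_ω^d` with
`v = u + a`, where `ω + k = ω`. -/
def IsPartialTransition {d : ℕ} (A : Set (Act d))
    (e : PConf d × Act d × PConf d) : Prop :=
  e.2.1 ∈ A ∧ ∀ i,
    (e.1 i = ⊤ ∧ e.2.2 i = ⊤) ∨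
    ∃ m n : ℕ, e.1 i = (m : ℕ∞) ∧ e.2.2 i = (n : ℕ∞) ∧
      (n : ℤ) = (m : ℤ) + e.2.1 i

/-- Ordering on triples of `ℕ^d × A × ℕ^d`: same action, componentwise smaller
source and target. -/
def TripLE {d : ℕ} (t t' : Trip d) : Prop :=
  t.2.1 = t'.2.1 ∧ (∀ i, t.1 i ≤ t'.1 i) ∧ (∀ i, t.2.2 i ≤ t'.2.2 i)

theorem natCast_le_biSup_iff {α : Type*} {S : Set α} (hS : S.Nonempty) (f : α → ℕ) (k : ℕ) :
    (k : ℕ∞) ≤ ⨆ s ∈ S, (f s : ℕ∞) ↔ ∃ s ∈ S, k ≤ f s := by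
  constructor
  · intro h
    cases k with
    | zero => exact hS.imp fun s hs => ⟨hs, Nat.zero_le _⟩
    | succ k =>
      have hk : (k : ℕ∞) < ⨆ s ∈ S, (f s : ℕ∞) :=
        lt_of_lt_of_le (by exact_mod_cast Nat.lt_succ_self k) h
      obtain ⟨s, hs⟩ := lt_iSup_iff.1 hk
      obtain ⟨hs, hks⟩ := lt_iSup_iff.1 hs
      exact ⟨s, hs, by exact_mod_cast hks⟩
  · rintro ⟨s, hs, hk⟩
    exact le_trans (by exact_mod_cast hk) (le_iSup₂ (f := fun s _ => (f s : ℕ∞)) s hs)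

theorem TripLE.trans {d : ℕ} {s t r : Trip d} (h : TripLE s t) (h' : TripLE t r) : TripLE s r :=
  ⟨h.1.trans h'.1, fun i => (h.2.1 i).trans (h'.2.1 i), fun i => (h.2.2 i).trans (h'.2.2 i)⟩

/-- In a nonempty directed set of triples, coordinatewise bounds can be realised
simultaneously. -/
theorem exists_mem_forall_le_of_directed {d : ℕ} {I : Set (Trip d)} (hne : I.Nonempty)
    (hdir : ∀ t₁ ∈ I, ∀ t₂ ∈ I, ∃ t ∈ I, TripLE t₁ t ∧ TripLE t₂ t) {u v : Conf d}
    (hu : ∀ i, ∃ s ∈ I, u i ≤ s.1 i) (hv : ∀ i, ∃ s ∈ I, v i ≤ s.2.2 i) :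
    ∃ s ∈ I, (∀ i, u i ≤ s.1 i) ∧ (∀ i, v i ≤ s.2.2 i) := by
  classical
  suffices h : ∀ F : Finset (Fin d), ∃ s ∈ I, ∀ i ∈ F, u i ≤ s.1 i ∧ v i ≤ s.2.2 i by
    obtain ⟨s, hs, h⟩ := h Finset.univ
    exact ⟨s, hs, fun i => (h i (Finset.mem_univ i)).1, fun i => (h i (Finset.mem_univ i)).2⟩
  intro F
  induction F using Finset.induction_on with
  | empty => exact hne.imp fun s hs => ⟨hs, by simp⟩
  | insert j F _ ih =>
    obtain ⟨s, hs, hsF⟩ := ih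
    obtain ⟨p, hp, hpj⟩ := hu j
    obtain ⟨q, hq, hqj⟩ := hv j
    obtain ⟨r, hr, hpr, hqr⟩ := hdir p hp q hq
    obtain ⟨w, hw, hsw, hrw⟩ := hdir s hs r hr
    refine ⟨w, hw, fun i hi => ?_⟩
    rcases Finset.mem_insert.1 hi with rfl | hi
    · exact ⟨hpj.trans ((hpr.trans hrw).2.1 i), hqj.trans ((hqr.trans hrw).2.2 i)⟩
    · exact ⟨(hsF i hi).1.trans (hsw.2.1 i), (hsF i hi).2.trans (hsw.2.2 i)⟩

/-- The coordinatewise suprema of a nonempty set of transitions sharing an action form a partial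
transition. -/
theorem isPartialTransition_biSup {d : ℕ} {A : Set (Act d)} {T : Set (Trip d)} {a : Act d}
    (hne : T.Nonempty) (hT : ∀ t ∈ T, IsTransition A t) (ha : ∀ t ∈ T, t.2.1 = a) :
    IsPartialTransition A
      (fun i => ⨆ t ∈ T, (t.1 i : ℕ∞), a, fun i => ⨆ t ∈ T, (t.2.2 i : ℕ∞)) := by
  obtain ⟨t₀, ht₀⟩ := hne
  refine ⟨ha t₀ ht₀ ▸ (hT t₀ ht₀).1, fun i => ?_⟩
  have hrel : ∀ t ∈ T, (t.2.2 i : ℤ) = t.1 i + a i := fun t ht => ha t ht ▸ (hT t ht).2 i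
  have hu := natCast_le_biSup_iff ⟨t₀, ht₀⟩ (fun t : Trip d => t.1 i)
  have hv := natCast_le_biSup_iff ⟨t₀, ht₀⟩ (fun t : Trip d => t.2.2 i)
  dsimp only at hu hv ⊢
  generalize (⨆ t ∈ T, (t.1 i : ℕ∞)) = x at hu ⊢
  generalize (⨆ t ∈ T, (t.2.2 i : ℕ∞)) = y at hv ⊢
  induction x using ENat.recTopCoe with
  | top =>
    induction y using ENat.recTopCoe with
    | top => exact Or.inl ⟨rfl, rfl⟩
    | coe n =>
      obtain ⟨s, hs, hk⟩ := (hu (n + 1 + (-a i).toNat)).1 le_top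
      have hn : s.2.2 i ≤ n := by exact_mod_cast (hv (s.2.2 i)).2 ⟨s, hs, le_rfl⟩
      have := hrel s hs
      omega
  | coe m =>
    induction y using ENat.recTopCoe with
    | top =>
      obtain ⟨s, hs, hk⟩ := (hv (m + 1 + (a i).toNat)).1 le_top
      have hm : s.1 i ≤ m := by exact_mod_cast (hu (s.1 i)).2 ⟨s, hs, le_rfl⟩
      have := hrel s hs
      omega
    | coe n =>
      refine Or.inr ⟨m, n, rfl, rfl, ?_⟩
      obtain ⟨s, hs, hms⟩ := (hu m).1 le_rfl
      obtain ⟨r, hr, hnr⟩ := (hv n).1 le_rfl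
      have hn : s.2.2 i ≤ n := by exact_mod_cast (hv (s.2.2 i)).2 ⟨s, hs, le_rfl⟩
      have hm : r.1 i ≤ m := by exact_mod_cast (hu (r.1 i)).2 ⟨r, hr, le_rfl⟩
      have hs := hrel s hs
      have hr := hrel r hr
      omega

/-- Every triple below a partial transition is below a transition that is itself below the partial
transition. -/
theorem IsPartialTransition.exists_isTransition {d : ℕ} {A : Set (Act d)}
    {e : PConf d × Act d × PConf d} (he : IsPartialTransition A e) {t : Trip d}
    (hta : t.2.1 = e.2.1) (htu : ∀ i, (t.1 i : ℕ∞) ≤ e.1 i)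
    (htv : ∀ i, (t.2.2 i : ℕ∞) ≤ e.2.2 i) :
    ∃ s : Trip d, IsTransition A s ∧ TripLE t s ∧ s.2.1 = e.2.1 ∧
      (∀ i, (s.1 i : ℕ∞) ≤ e.1 i) ∧ (∀ i, (s.2.2 i : ℕ∞) ≤ e.2.2 i) := by
  have h : ∀ i, ∃ m n : ℕ, (n : ℤ) = m + e.2.1 i ∧ t.1 i ≤ m ∧ t.2.2 i ≤ n ∧
      (m : ℕ∞) ≤ e.1 i ∧ (n : ℕ∞) ≤ e.2.2 i := by
    intro i
    rcases he.2 i with ⟨hu, hv⟩ | ⟨m, n, hu, hv, hmn⟩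
    · refine ⟨t.1 i + t.2.2 i + (-e.2.1 i).toNat, t.1 i + t.2.2 i + (e.2.1 i).toNat,
        by omega, by omega, by omega, ?_, ?_⟩
      · simp [hu]
      · simp [hv]
    · have hm := htu i
      have hn := htv i
      rw [hu] at hm
      rw [hv] at hn
      exact ⟨m, n, hmn, by exact_mod_cast hm, by exact_mod_cast hn, hu.ge, hv.ge⟩
  choose m n hmn hm hn hmu hnv using h
  exact ⟨(m, e.2.1, n), ⟨he.1, hmn⟩, ⟨hta, hm, hn⟩, rfl, hmu, hnv⟩

/-- The transition ideals of `ℕ^d × A × ℕ^d` — the ideals (nonempty,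
downward-closed, directed subsets) that are downward closures of sets of
transitions — are exactly the sets `↓e` for `e` a partial transition. -/
theorem transition_ideals {d : ℕ} (A : Set (Act d)) (hA : A.Finite)
    (I : Set (Trip d)) :
    (I.Nonempty ∧
      (∀ t t' : Trip d, TripLE t t' → t' ∈ I → t ∈ I) ∧
      (∀ t₁ ∈ I, ∀ t₂ ∈ I, ∃ t ∈ I, TripLE t₁ t ∧ TripLE t₂ t) ∧
      ∃ T : Set (Trip d), (∀ t ∈ T, IsTransition A t) ∧
        I = {t' : Trip d | ∃ t ∈ T, TripLE t' t}) ↔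
    (∃ e : PConf d × Act d × PConf d, IsPartialTransition A e ∧
      I = {t : Trip d | t.2.1 = e.2.1 ∧ (∀ i, (t.1 i : ℕ∞) ≤ e.1 i) ∧
            (∀ i, (t.2.2 i : ℕ∞) ≤ e.2.2 i)}) := by
  constructor
  · rintro ⟨⟨t₀, ht₀⟩, hdown, hdir, T, hT, rfl⟩
    have hTI : ∀ t ∈ T, ∃ s ∈ T, TripLE t s :=
      fun t ht => ⟨t, ht, rfl, fun _ => le_rfl, fun _ => le_rfl⟩
    have hne : T.Nonempty := ht₀.imp fun _ h => h.1
    have ha : ∀ t : Trip d, (∃ s ∈ T, TripLE t s) → t.2.1 = t₀.2.1 := by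
      intro t ht
      obtain ⟨r, -, h₁, h₂⟩ := hdir t ht t₀ ht₀
      exact h₁.1.trans h₂.1.symm
    refine ⟨_, isPartialTransition_biSup hne hT fun t ht => ha t (hTI t ht), ?_⟩
    ext t
    simp only [Set.mem_ofPred_eq, natCast_le_biSup_iff hne (fun t : Trip d => t.1 _),
      natCast_le_biSup_iff hne (fun t : Trip d => t.2.2 _)]
    constructor
    · rintro ⟨s, hs, hts⟩
      exact ⟨ha t ⟨s, hs, hts⟩, fun i => ⟨s, hs, hts.2.1 i⟩, fun i => ⟨s, hs, hts.2.2 i⟩⟩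
    · rintro ⟨hta, htu, htv⟩
      obtain ⟨s, hs, hsu, hsv⟩ := exists_mem_forall_le_of_directed ⟨t₀, ht₀⟩ hdir
        (fun i => (htu i).imp fun s hs => ⟨hTI s hs.1, hs.2⟩)
        (fun i => (htv i).imp fun s hs => ⟨hTI s hs.1, hs.2⟩)
      exact hdown t s ⟨hta.trans (ha s hs).symm, hsu, hsv⟩ hs
  · rintro ⟨e, he, rfl⟩
    have hdown : ∀ t t' : Trip d, TripLE t t' →
        (t'.2.1 = e.2.1 ∧ (∀ i, (t'.1 i : ℕ∞) ≤ e.1 i) ∧ (∀ i, (t'.2.2 i : ℕ∞) ≤ e.2.2 i)) →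
        (t.2.1 = e.2.1 ∧ (∀ i, (t.1 i : ℕ∞) ≤ e.1 i) ∧ (∀ i, (t.2.2 i : ℕ∞) ≤ e.2.2 i)) :=
      fun t t' h h' => ⟨h.1.trans h'.1,
        fun i => (Nat.cast_le.2 (h.2.1 i)).trans (h'.2.1 i),
        fun i => (Nat.cast_le.2 (h.2.2 i)).trans (h'.2.2 i)⟩
    refine ⟨⟨(0, e.2.1, 0), rfl, by simp, by simp⟩, hdown, ?_,
      {t | IsTransition A t ∧ t.2.1 = e.2.1 ∧ (∀ i, (t.1 i : ℕ∞) ≤ e.1 i) ∧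
        (∀ i, (t.2.2 i : ℕ∞) ≤ e.2.2 i)}, fun t ht => ht.1, ?_⟩
    · rintro t₁ ⟨ha₁, hu₁, hv₁⟩ t₂ ⟨ha₂, hu₂, hv₂⟩
      refine ⟨(t₁.1 ⊔ t₂.1, e.2.1, t₁.2.2 ⊔ t₂.2.2), ⟨rfl, fun i => ?_, fun i => ?_⟩,
        ⟨ha₁, fun i => le_sup_left, fun i => le_sup_left⟩,
        ⟨ha₂, fun i => le_sup_right, fun i => le_sup_right⟩⟩
      · exact (Nat.mono_cast.map_max (β := ℕ∞)).trans_le (max_le (hu₁ i) (hu₂ i))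
      · exact (Nat.mono_cast.map_max (β := ℕ∞)).trans_le (max_le (hv₁ i) (hv₂ i))
    · ext t
      constructor
      · rintro ⟨hta, htu, htv⟩
        obtain ⟨s, hs, hts, hse⟩ := he.exists_isTransition hta htu htv
        exact ⟨s, ⟨hs, hse⟩, hts⟩
      · rintro ⟨s, ⟨-, hse⟩, hts⟩
        exact hdown t s hts hse
end

section
/- Let γ = (c,P) with c ∈ ℕ^d and P ⊆ ℕ^d × ℕ^d a periodic set included in the transformer relation ↝_c, and let h be an intraproduction for γ. If h(i) > 0 for some index i, then i ∉ F_γ. -/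
/-- A subset `P` of `ℕ^d × ℕ^d` is periodic if it contains the zero vector and
is closed under componentwise addition. -/
def PeriodicPairs {d : ℕ} (P : Set (Conf d × Conf d)) : Prop :=
  (0, 0) ∈ P ∧ ∀ p ∈ P, ∀ q ∈ P, p + q ∈ P

/-- The transformer relation with capacity `c`: `u ↝_c v` iff there is a run
from `u + c` to `v + c`. -/
def Transformer {d : ℕ} (A : Set (Act d)) (c : Conf d) (u v : Conf d) : Prop :=
  ∃ w : List (Trip d), IsRun A (u + c, w, v + c)

/-- Membership in `Ω_γ` for `γ = (c, P)`: the runs from `c + u` to `c + v`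
with `(u, v) ∈ P`. -/
def InOmega {d : ℕ} (A : Set (Act d)) (c : Conf d) (P : Set (Conf d × Conf d))
    (ρ : PreRun d) : Prop :=
  IsRun A ρ ∧ ∃ p ∈ P, ρ.1 = c + p.1 ∧ ρ.2.2 = c + p.2

/-- The configuration `q` occurs along the prerun `ρ`. -/
def OccursIn {d : ℕ} (q : Conf d) (ρ : PreRun d) : Prop :=
  q = ρ.1 ∨ q = ρ.2.2 ∨ ∃ t ∈ ρ.2.1, q = t.1 ∨ q = t.2.2

/-- `Q_γ`: the set of configurations occurring along runs of `Ω_γ`. -/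
def Qgamma {d : ℕ} (A : Set (Act d)) (c : Conf d)
    (P : Set (Conf d × Conf d)) : Set (Conf d) :=
  {q : Conf d | ∃ ρ : PreRun d, InOmega A c P ρ ∧ OccursIn q ρ}

/-- `F_γ`: the set of indices on which `Q_γ` is bounded, i.e. such that
`{q i | q ∈ Q_γ}` is finite. -/
def Fgamma {d : ℕ} (A : Set (Act d)) (c : Conf d)
    (P : Set (Conf d × Conf d)) : Set (Fin d) :=
  {i : Fin d | ((fun q : Conf d => q i) '' Qgamma A c P).Finite}

/-- One step of the VAS `A`. -/
def VASStep {d : ℕ} (A : Set (Act d)) (u v : Conf d) : Prop :=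
  ∃ a, IsTransition A (u, a, v)

/-- Reachability in the VAS `A`. -/
abbrev VASReach {d : ℕ} (A : Set (Act d)) : Conf d → Conf d → Prop :=
  Relation.ReflTransGen (VASStep A)

lemma VASReach.add_right {d : ℕ} {A : Set (Act d)} {u v : Conf d}
    (huv : VASReach A u v) (z : Conf d) : VASReach A (u + z) (v + z) := by
  refine Relation.ReflTransGen.lift (· + z) ?_ _ _ huv
  rintro x y ⟨a, ha, hxy⟩
  refine ⟨a, ha, fun j => ?_⟩
  have := hxy j
  simp only [Pi.add_apply, Nat.cast_add] at this ⊢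
  omega

lemma VASReach.nsmul {d : ℕ} {A : Set (Act d)} {c x y : Conf d}
    (hxy : VASReach A (c + x) (c + y)) (n : ℕ) :
    VASReach A (c + n • x) (c + n • y) := by
  induction n with
  | zero => simpa using Relation.ReflTransGen.refl
  | succ n ih =>
    have h₁ := ih.add_right x
    have h₂ := hxy.add_right (n • y)
    rw [add_assoc, ← succ_nsmul] at h₁
    rw [add_right_comm, add_assoc c y, ← succ_nsmul'] at h₂
    exact h₁.trans h₂

lemma ChainFrom.append {d : ℕ} {x y z : Conf d} {w₁ w₂ : List (Trip d)}
    (h₁ : ChainFrom x w₁ y) (h₂ : ChainFrom y w₂ z) :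
    ChainFrom x (w₁ ++ w₂) z := by
  induction w₁ generalizing x with
  | nil =>
    obtain rfl : x = y := h₁
    exact h₂
  | cons t w ih => exact ⟨h₁.1, ih h₁.2⟩

lemma VASReach.exists_isRun {d : ℕ} {A : Set (Act d)} {x y : Conf d}
    (hxy : VASReach A x y) : ∃ w, IsRun A (x, w, y) := by
  induction hxy using Relation.ReflTransGen.head_induction_on with
  | refl => exact ⟨[], by simp, rfl⟩
  | head hstep _ ih =>
    obtain ⟨a, ha⟩ := hstep
    obtain ⟨w, hw, hc⟩ := ih
    exact ⟨(_, a, _) :: w, List.forall_mem_cons.2 ⟨ha, hw⟩, rfl, hc⟩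

lemma IsRun.reach {d : ℕ} {A : Set (Act d)} {x y : Conf d} {w : List (Trip d)}
    (hw : IsRun A (x, w, y)) : VASReach A x y := by
  induction w generalizing x with
  | nil =>
    obtain rfl : x = y := hw.2
    exact .refl
  | cons t w ih =>
    obtain ⟨hA, rfl, hc⟩ := hw
    obtain ⟨ht, hA⟩ := List.forall_mem_cons.1 hA
    exact .head ⟨t.2.1, ht⟩ (ih ⟨hA, hc⟩)

lemma IsRun.reach_of_occursIn {d : ℕ} {A : Set (Act d)} {x y q : Conf d}
    {w : List (Trip d)} (hw : IsRun A (x, w, y)) (hq : OccursIn q (x, w, y)) :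
    VASReach A x q ∧ VASReach A q y := by
  induction w generalizing x with
  | nil =>
    obtain rfl : x = y := hw.2
    obtain rfl : q = x := by simpa [OccursIn] using hq
    exact ⟨.refl, .refl⟩
  | cons t w ih =>
    have hr := hw.reach
    obtain ⟨hA, rfl, hc⟩ := hw
    obtain ⟨ht, hA⟩ := List.forall_mem_cons.1 hA
    have tail (hq : OccursIn q (t.2.2, w, y)) : VASReach A t.1 q ∧ VASReach A q y :=
      (ih ⟨hA, hc⟩ hq).imp_left (.head ⟨t.2.1, ht⟩)
    rcases hq with rfl | rfl | ⟨s, hs, hq⟩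
    · exact ⟨.refl, hr⟩
    · exact ⟨hr, .refl⟩
    · rcases List.mem_cons.1 hs with rfl | hs
      · rcases hq with rfl | hq
        · exact ⟨.refl, hr⟩
        · exact tail (.inl hq)
      · exact tail (.inr (.inr ⟨s, hs, hq⟩))

lemma VASReach.exists_isRun_occursIn {d : ℕ} {A : Set (Act d)} {x q y : Conf d}
    (hxq : VASReach A x q) (hqy : VASReach A q y) :
    ∃ w, IsRun A (x, w, y) ∧ OccursIn q (x, w, y) := by
  obtain ⟨w₁, hA₁, hc₁⟩ := hxq.exists_isRun
  obtain ⟨w₂, hA₂, hc₂⟩ := hqy.exists_isRun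
  refine ⟨w₁ ++ w₂, ⟨fun t ht => ?_, hc₁.append hc₂⟩, ?_⟩
  · exact (List.mem_append.1 ht).elim (hA₁ t) (hA₂ t)
  · cases w₂ with
    | nil => exact .inr (.inl hc₂)
    | cons t w => exact .inr (.inr ⟨t, by simp, .inl hc₂.1.symm⟩)

lemma PeriodicPairs.nsmul_mem {d : ℕ} {P : Set (Conf d × Conf d)}
    (hP : PeriodicPairs P) {p : Conf d × Conf d} (hp : p ∈ P) (n : ℕ) : n • p ∈ P := by
  induction n with
  | zero => exact (zero_nsmul p).symm ▸ hP.1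
  | succ n ih =>
    rw [succ_nsmul]
    exact hP.2 _ ih _ hp

/-- Multiples of intraproductions are intraproductions. -/
lemma PeriodicPairs.add_nsmul_mem_Qgamma {d : ℕ} {A : Set (Act d)} {c h : Conf d}
    {P : Set (Conf d × Conf d)} (hP : PeriodicPairs P)
    (hh : c + h ∈ Qgamma A c P) (n : ℕ) : c + n • h ∈ Qgamma A c P := by
  obtain ⟨⟨_, w, _⟩, ⟨hrun, p, hp, rfl, rfl⟩, hocc⟩ := hh
  obtain ⟨h₁, h₂⟩ := hrun.reach_of_occursIn hocc
  obtain ⟨w', hrun', hocc'⟩ := (h₁.nsmul n).exists_isRun_occursIn (h₂.nsmul n)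
  exact ⟨_, ⟨hrun', n • p, hP.nsmul_mem hp n, rfl, rfl⟩, hocc'⟩

/-- Let `γ = (c, P)` with `P ⊆ ℕ^d × ℕ^d` periodic and included in the
transformer relation `↝_c`, and let `h` be an intraproduction for `γ`, i.e.
`c + h ∈ Q_γ`.  If `h i > 0` for some index `i`, then `i ∉ F_γ`. -/
theorem intraproduction_support_not_bounded {d : ℕ} (A : Set (Act d))
    (hA : A.Finite) (c : Conf d) (P : Set (Conf d × Conf d))
    (hper : PeriodicPairs P)
    (hPc : ∀ p ∈ P, Transformer A c p.1 p.2)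
    (h : Conf d) (hh : c + h ∈ Qgamma A c P)
    (i : Fin d) (hi : 0 < h i) :
    i ∉ Fgamma A c P := by
  intro hfin
  have hmem (n : ℕ) : (c + n • h) i ∈ (fun q : Conf d => q i) '' Qgamma A c P :=
    ⟨_, hper.add_nsmul_mem_Qgamma hh n, rfl⟩
  refine Set.infinite_of_injective_forall_mem (fun m n hmn => ?_) hmem hfin
  have hmul : m * h i = n * h i := by simpa using hmn
  exact Nat.eq_of_mul_eq_mul_right hi hmul
end

section
/- VAS reachability is decidable: for every dimension d and every finite set A ⊆ ℤ^d of actions, the predicate on pairs of configurations (x,y) ∈ ℕ^d × ℕ^d that holds if and only if there exists a run of the VAS A from x to y (i.e. Runs(x,y) ≠ ∅) is a computable (algorithmically decidable) predicate. -/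
namespace VAS

variable {ι : Type*}

/-- `Step A u v` holds when `v` is obtained from `u` by one action of `A`. -/
def Step (A : Set (ι → ℤ)) (u v : ι → ℕ) : Prop :=
  ∃ a ∈ A, ∀ i, (v i : ℤ) = u i + a i

/-- Reachability in the vector addition system `A`. -/
def Reach (A : Set (ι → ℤ)) : (ι → ℕ) → (ι → ℕ) → Prop :=
  Relation.ReflTransGen (Step A)

variable {A : Set (ι → ℤ)} {u v w x y : ι → ℕ}

theorem Reach.refl (u : ι → ℕ) : Reach A u u := Relation.ReflTransGen.refl

theorem Reach.trans (h : Reach A u v) (h' : Reach A v w) : Reach A u w :=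
  Relation.ReflTransGen.trans h h'

theorem Step.reach (h : Step A u v) : Reach A u v := Relation.ReflTransGen.single h

theorem Step.add_right (h : Step A u v) (w : ι → ℕ) : Step A (u + w) (v + w) := by
  obtain ⟨a, ha, h⟩ := h
  refine ⟨a, ha, fun i => ?_⟩
  simp only [Pi.add_apply, Nat.cast_add, h i]
  ring

theorem Reach.add_right (h : Reach A u v) (w : ι → ℕ) : Reach A (u + w) (v + w) :=
  Relation.ReflTransGen.lift (· + w) (fun _ _ (h : Step A _ _) => h.add_right w) _ _ h

theorem Reach.add {c r s r' s' : ι → ℕ} (h : Reach A (c + r) (c + s))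
    (h' : Reach A (c + r') (c + s')) : Reach A (c + (r + r')) (c + (s + s')) := by
  have h₁ := h.add_right r'
  have h₂ := h'.add_right s
  rw [add_assoc] at h₁ h₂
  rw [add_assoc, add_comm r' s, add_comm s' s] at h₂
  rw [add_assoc] at h₁
  exact h₁.trans h₂

theorem Reach.nsmul {c r s : ι → ℕ} (h : Reach A (c + r) (c + s)) (k : ℕ) :
    Reach A (c + k • r) (c + k • s) := by
  induction k with
  | zero => simpa using Reach.refl c
  | succ k ih => simpa only [succ_nsmul] using ih.add h

theorem step_neg : Step (-A) u v ↔ Step A v u := by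
  constructor
  · rintro ⟨a, ha, h⟩
    exact ⟨-a, ha, fun i => by simp [h i]⟩
  · rintro ⟨a, ha, h⟩
    exact ⟨-a, by simpa using ha, fun i => by simp [h i]⟩

theorem reach_neg : Reach (-A) u v ↔ Reach A v u := by
  unfold Reach
  rw [← Relation.reflTransGen_swap]
  have : Function.swap (Step (-A)) = Step A := by
    ext a b
    exact step_neg
  rw [this]

/-- `L` is a finitely generated monoid that contains `P`, is included in the group generated by `P`,
and consists of limits of `P`. -/
def IsLinearization {M : Type*} [AddCommMonoid M] (P L : AddSubmonoid M) : Prop :=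
  L.FG ∧ P ≤ L ∧ (∀ g ∈ L, ∃ p ∈ P, ∃ q ∈ P, g + q = p) ∧
    ∃ t ∈ P, ∀ g ∈ L, ∃ k > 0, k • (t + g) ∈ P

/-- A submonoid is linearizable when it has a linearization. -/
def Linearizable {M : Type*} [AddCommMonoid M] (P : AddSubmonoid M) : Prop :=
  ∃ L, IsLinearization P L

theorem Linearizable.map {M N : Type*} [AddCommMonoid M] [AddCommMonoid N] {P : AddSubmonoid M}
    (h : Linearizable P) (f : M →+ N) : Linearizable (P.map f) := by
  obtain ⟨L, hL, hPL, hd, t, ht, hlim⟩ := h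
  refine ⟨L.map f, hL.map f, AddSubmonoid.monotone_map hPL, ?_, f t, ⟨t, ht, rfl⟩, ?_⟩
  · rintro _ ⟨g, hg, rfl⟩
    obtain ⟨p, hp, q, hq, h⟩ := hd g hg
    exact ⟨f p, ⟨p, hp, rfl⟩, f q, ⟨q, hq, rfl⟩, by rw [← h, map_add]⟩
  · rintro _ ⟨g, hg, rfl⟩
    obtain ⟨k, hk, h⟩ := hlim g hg
    exact ⟨k, hk, _, h, by simp⟩

/-- A walk of length `n` and effect `e` in the finite graph on `S` whose edges are the actions
of `A`, seen on the coordinates in `J` only. -/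
inductive Walk (A : Set (ι → ℤ)) (S : Set (ι → ℕ)) (J : ι → Prop) :
    ℕ → (ι → ℕ) → (ι → ℤ) → (ι → ℕ) → Prop
  | nil {z} : z ∈ S → Walk A S J 0 z 0 z
  | cons {n z a z' e z''} : z ∈ S → a ∈ A → (∀ i, J i → (z' i : ℤ) = z i + a i) →
      Walk A S J n z' e z'' → Walk A S J (n + 1) z (a + e) z''

namespace Walk

variable {S : Set (ι → ℕ)} {J : ι → Prop} {m n : ℕ} {z z' z'' : ι → ℕ} {e e' : ι → ℤ}

theorem source_mem (h : Walk A S J n z e z') : z ∈ S := by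
  cases h <;> assumption

theorem append (h : Walk A S J m z e z') (h' : Walk A S J n z' e' z'') :
    Walk A S J (m + n) z (e + e') z'' := by
  induction h with
  | nil => simpa using h'
  | cons hz ha hs _ ih =>
    have := cons hz ha hs (ih h')
    rwa [← add_assoc, Nat.add_right_comm] at this

/-- A walk either contains a loop, or visits `n + 1` distinct vertices. -/
theorem exists_loop_or (h : Walk A S J n z e z') :
    (∃ n₁ l n₂ v e₁ e₂ e₃, 0 < l ∧ n = n₁ + l + n₂ ∧ e = e₁ + e₂ + e₃ ∧
      Walk A S J n₁ z e₁ v ∧ Walk A S J l v e₂ v ∧ Walk A S J n₂ v e₃ z') ∨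
    ∃ V : Finset (ι → ℕ), V.card = n + 1 ∧ ∀ v ∈ V, v ∈ S ∧ ∃ n₁ n₂ e₁ e₂,
      n = n₁ + n₂ ∧ e = e₁ + e₂ ∧ Walk A S J n₁ z e₁ v ∧ Walk A S J n₂ v e₂ z' := by
  classical
  induction h with
  | @nil z hz =>
    refine Or.inr ⟨{z}, by simp, fun v hv => ?_⟩
    obtain rfl := Finset.mem_singleton.1 hv
    exact ⟨hz, 0, 0, 0, 0, by simp, by simp, nil hz, nil hz⟩
  | @cons n z a z₁ e z₂ hz ha hs hw ih =>
    rcases ih with ⟨n₁, l, n₂, v, e₁, e₂, e₃, hl, rfl, rfl, h₁, h₂, h₃⟩ | ⟨V, hV, h⟩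
    · exact Or.inl ⟨n₁ + 1, l, n₂, v, a + e₁, e₂, e₃, hl, by ring, by simp only [add_assoc],
        cons hz ha hs h₁, h₂, h₃⟩
    · by_cases hzV : z ∈ V
      · obtain ⟨-, n₁, n₂, e₁, e₂, rfl, rfl, h₁, h₂⟩ := h z hzV
        exact Or.inl ⟨0, n₁ + 1, n₂, z, 0, a + e₁, e₂, by simp, by ring, by simp [add_assoc],
          nil hz, cons hz ha hs h₁, h₂⟩
      · refine Or.inr ⟨insert z V, by simp [hzV, hV], fun v hv => ?_⟩
        rcases Finset.mem_insert.1 hv with rfl | hv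
        · exact ⟨hz, 0, n + 1, 0, a + e, by simp, by simp, nil hz, cons hz ha hs hw⟩
        · obtain ⟨hvS, n₁, n₂, e₁, e₂, rfl, rfl, h₁, h₂⟩ := h v hv
          exact ⟨hvS, n₁ + 1, n₂, a + e₁, e₂, by ring, by simp [add_assoc],
            cons hz ha hs h₁, h₂⟩

/-- Effects of closed walks are sums of effects of short closed walks. -/
theorem effect_mem_closure (hS : S.Finite) (h : Walk A S J n z e z) :
    e ∈ AddSubmonoid.closure {e | ∃ m ≤ S.ncard, ∃ v, Walk A S J m v e v} := by
  induction n using Nat.strong_induction_on generalizing z e with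
  | _ n ih =>
    by_cases hn : n ≤ S.ncard
    · exact AddSubmonoid.subset_closure ⟨n, hn, z, h⟩
    · cases h with
      | nil => simp at hn
      | @cons n _ a z₁ e _ hz ha hs hw =>
        rcases hw.exists_loop_or with
          ⟨n₁, l, n₂, v, e₁, e₂, e₃, hl, rfl, rfl, h₁, h₂, h₃⟩ | ⟨V, hV, h⟩
        · have hloop := ih l (by omega) h₂
          have hrest := ih (n₁ + 1 + n₂) (by omega) ((cons hz ha hs h₁).append h₃)
          have : a + (e₁ + e₂ + e₃) = e₂ + (a + e₁ + e₃) := by abel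
          rw [this]
          exact add_mem hloop hrest
        · have hVS : (V : Set (ι → ℕ)) ⊆ S := fun v hv => (h v hv).1
          have := Set.ncard_le_ncard hVS hS
          rw [Set.ncard_coe_finset] at this
          omega

theorem finite_effects (hA : A.Finite) (n : ℕ) : {e | ∃ z z', Walk A S J n z e z'}.Finite := by
  induction n with
  | zero =>
    refine (Set.finite_singleton 0).subset ?_
    rintro e ⟨z, z', h⟩
    cases h
    rfl
  | succ n ih =>
    refine (hA.add ih).subset ?_
    rintro e ⟨z, z', h⟩
    cases h with
    | cons _ ha _ h => exact Set.add_mem_add ha ⟨_, _, h⟩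

/-- A walk lifts to a run from all configurations that are large outside `J`. -/
theorem lift [Finite ι] (h : Walk A S J n z e z') :
    ∃ N : ℕ, ∀ x : ι → ℕ, (∀ i, J i → x i = z i) → (∀ i, ¬ J i → N ≤ x i) →
      ∀ y : ι → ℕ, (∀ i, (y i : ℤ) = x i + e i) → Reach A x y := by
  induction h with
  | nil =>
    refine ⟨0, fun x _ _ y hy => ?_⟩
    have : y = x := by
      ext i
      simpa using hy i
    rw [this]
    exact Reach.refl x
  | @cons n z a z₁ e z₂ hz ha hs hw ih =>
    have := Fintype.ofFinite ι
    obtain ⟨N, hN⟩ := ih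
    refine ⟨N + ∑ i, (a i).natAbs, fun x hJ hx y hy => ?_⟩
    have hbd (i) (hi : ¬ J i) : (N : ℤ) ≤ x i + a i := by
      have h₁ := Finset.single_le_sum (f := fun i => (a i).natAbs) (fun _ _ => Nat.zero_le _)
        (Finset.mem_univ i)
      have h₂ := hx i hi
      omega
    have hstep (i) : (((x i + a i).toNat : ℕ) : ℤ) = x i + a i := by
      refine Int.toNat_of_nonneg ?_
      by_cases hi : J i
      · rw [hJ i hi, ← hs i hi]
        positivity
      · have := hbd i hi
        omega
    refine (Step.reach (v := fun i => (x i + a i).toNat) ⟨a, ha, hstep⟩).trans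
      (hN _ (fun i hi => ?_) (fun i hi => ?_) y (fun i => ?_))
    · have := hs i hi
      rw [← hJ i hi] at this
      omega
    · have := hbd i hi
      omega
    · rw [hstep, hy, Pi.add_apply]
      ring

end Walk

end VAS

namespace VAS

variable {ι : Type*} {A : Set (ι → ℤ)} {u v w x y : ι → ℕ}

/-- The submonoid of parameters `l` such that `c + g l` is reachable from `c + f l`. -/
def production {M : Type*} [AddCommMonoid M] (A : Set (ι → ℤ)) (c : ι → ℕ)
    (f g : M →+ (ι → ℕ)) : AddSubmonoid M where
  carrier := {l | Reach A (c + f l) (c + g l)}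
  zero_mem' := by simpa using Reach.refl c
  add_mem' {a b} ha hb := by simpa only [Set.mem_ofPred_eq, map_add] using Reach.add ha hb

section Production

variable {M : Type*} [AddCommMonoid M] {c : ι → ℕ} {f g : M →+ (ι → ℕ)}

theorem mem_production {l : M} : l ∈ production A c f g ↔ Reach A (c + f l) (c + g l) :=
  Iff.rfl

/-- The configurations visited by the runs that define `production A c f g`. -/
def visited (A : Set (ι → ℤ)) (c : ι → ℕ) (f g : M →+ (ι → ℕ)) : Set (ι → ℕ) :=
  {x | ∃ l, Reach A (c + f l) x ∧ Reach A x (c + g l)}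

/-- The vectors `q` such that `c + q` is visited. -/
def intraproduction (A : Set (ι → ℤ)) (c : ι → ℕ) (f g : M →+ (ι → ℕ)) :
    AddSubmonoid (ι → ℕ) where
  carrier := {q | c + q ∈ visited A c f g}
  zero_mem' := ⟨0, by simpa using Reach.refl c, by simpa using Reach.refl c⟩
  add_mem' := by
    rintro q q' ⟨l, h₁, h₂⟩ ⟨l', h₁', h₂'⟩
    exact ⟨l + l', by simpa only [map_add] using h₁.add h₁',
      by simpa only [map_add] using h₂.add h₂'⟩

/-- A coordinate is frozen when no intraproduction is positive there. -/
def Frozen (A : Set (ι → ℤ)) (c : ι → ℕ) (f g : M →+ (ι → ℕ)) (i : ι) : Prop :=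
  ∀ q ∈ intraproduction A c f g, q i = 0

open Classical in
/-- The restriction of a configuration to its frozen coordinates. -/
noncomputable def restrict (J : ι → Prop) (x : ι → ℕ) : ι → ℕ := fun i => if J i then x i else 0

theorem restrict_apply {J : ι → Prop} {i : ι} (hi : J i) : restrict J x i = x i := if_pos hi

theorem restrict_congr {J : ι → Prop} (h : ∀ i, J i → x i = y i) :
    restrict J x = restrict J y := by
  ext i
  by_cases hi : J i
  · simp [restrict, hi, h i hi]
  · simp [restrict, hi]

theorem exists_intraproduction_pos [Finite ι] :
    ∃ q ∈ intraproduction A c f g, ∀ i, ¬ Frozen A c f g i → 0 < q i := by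
  classical
  have := Fintype.ofFinite ι
  have h (i) : ∃ q ∈ intraproduction A c f g, ¬ Frozen A c f g i → 0 < q i := by
    by_cases hi : Frozen A c f g i
    · exact ⟨0, zero_mem _, fun h => absurd hi h⟩
    · unfold Frozen at hi
      push Not at hi
      obtain ⟨q, hq, hi⟩ := hi
      exact ⟨q, hq, fun _ => Nat.pos_of_ne_zero hi⟩
  choose q hq hpos using h
  refine ⟨∑ j, q j, sum_mem fun j _ => hq j, fun i hi => (hpos i hi).trans_le ?_⟩
  rw [Finset.sum_apply]
  exact Finset.single_le_sum (f := fun j => q j i) (fun _ _ => Nat.zero_le _) (Finset.mem_univ i)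

theorem add_mem_intraproduction {δ : ι → ℕ} {l l' : M} (h₁ : Reach A (c + f l) x)
    (h₂ : Reach A x (c + g l)) (h₁' : Reach A (c + f l') (x + δ))
    (h₂' : Reach A (x + δ) (c + g l')) :
    f l + g l + δ ∈ intraproduction A c f g := by
  refine ⟨l + l', ?_, ?_⟩
  · have h₃ := h₁'.add_right (f l)
    have h₄ := h₂.add_right (δ + f l)
    convert h₃.trans (by convert h₄ using 1; abel) using 1
    · rw [map_add]; abel
    · abel
  · have h₃ := h₁.add_right (δ + g l)
    have h₄ := h₂'.add_right (g l)
    convert (show Reach A (c + f l + (δ + g l)) (x + δ + g l) by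
      convert h₃ using 1; abel).trans h₄ using 1
    · abel
    · rw [map_add]; abel

theorem finite_restrict_visited [Finite ι] :
    (restrict (Frozen A c f g) '' visited A c f g).Finite := by
  by_contra hinf
  have hinf : Set.Infinite _ := hinf
  choose r hr hrx using fun n => (hinf.natEmbedding _ n).2
  have hwqo := wellQuasiOrdered_le (α := ι → ℕ) r
  obtain ⟨m, n, hmn, hle⟩ := hwqo
  have hne : restrict (Frozen A c f g) (r m) ≠ restrict (Frozen A c f g) (r n) := by
    rw [hrx, hrx, Subtype.coe_ne_coe]
    exact (hinf.natEmbedding _).injective.ne hmn.ne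
  obtain ⟨δ, hδ⟩ := exists_add_of_le hle
  obtain ⟨l, h₁, h₂⟩ := hr m
  obtain ⟨l', h₁', h₂'⟩ := hr n
  rw [hδ] at h₁' h₂'
  have hq := add_mem_intraproduction h₁ h₂ h₁' h₂'
  refine hne (restrict_congr fun i hi => ?_)
  have := hi _ hq
  simp only [Pi.add_apply] at this
  simp only [hδ, Pi.add_apply]
  omega

theorem source_mem_intraproduction {l : M} (h : l ∈ production A c f g) :
    f l ∈ intraproduction A c f g := ⟨l, Reach.refl _, h⟩

theorem target_mem_intraproduction {l : M} (h : l ∈ production A c f g) :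
    g l ∈ intraproduction A c f g := ⟨l, h, Reach.refl _⟩

theorem exists_walk {l : M} (h₁ : Reach A (c + f l) x) (h₂ : Reach A x y)
    (h₃ : Reach A y (c + g l)) :
    ∃ n, Walk A (restrict (Frozen A c f g) '' visited A c f g) (Frozen A c f g) n
      (restrict (Frozen A c f g) x) (fun i => (y i : ℤ) - x i) (restrict (Frozen A c f g) y) := by
  induction h₂ using Relation.ReflTransGen.head_induction_on with
  | refl =>
    have hy : y ∈ visited A c f g := ⟨l, h₁, h₃⟩
    refine ⟨0, ?_⟩
    convert Walk.nil (Set.mem_image_of_mem (restrict (Frozen A c f g)) hy) using 1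
    ext i
    simp
  | @head x z hxz hzy ih =>
    obtain ⟨n, hn⟩ := ih (h₁.trans hxz.reach)
    obtain ⟨a, ha, hxz'⟩ := id hxz
    have hx : x ∈ visited A c f g := ⟨l, h₁, hxz.reach.trans (Reach.trans hzy h₃)⟩
    refine ⟨n + 1, ?_⟩
    convert Walk.cons (Set.mem_image_of_mem (restrict (Frozen A c f g)) hx) ha
      (fun i hi => ?_) hn using 1
    · ext i
      simp only [Pi.add_apply, hxz' i]
      ring
    · rw [restrict_apply hi, restrict_apply hi, hxz']

/-- Combine a tour of all the vertices with closed walks at these vertices. -/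
theorem exists_tour {S : Set (ι → ℕ)} {J : ι → Prop} {z₀ : ι → ℕ} (hz₀ : z₀ ∈ S)
    {a b ζ : (ι → ℕ) → ι → ℤ} (s : Finset (ι → ℕ))
    (ha : ∀ z ∈ s, ∃ n, Walk A S J n z₀ (a z) z) (hb : ∀ z ∈ s, ∃ n, Walk A S J n z (b z) z₀)
    (hζ : ∀ z ∈ s, ∃ n, Walk A S J n z (ζ z) z) :
    ∃ n, Walk A S J n z₀ (∑ z ∈ s, (a z + ζ z + b z)) z₀ := by
  classical
  induction s using Finset.induction_on with
  | empty => exact ⟨0, by simpa using Walk.nil hz₀⟩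
  | insert z s hz ih =>
    obtain ⟨n, hn⟩ := ih (fun v hv => ha v (by simp [hv])) (fun v hv => hb v (by simp [hv]))
      (fun v hv => hζ v (by simp [hv]))
    obtain ⟨n₁, h₁⟩ := ha z (by simp)
    obtain ⟨n₂, h₂⟩ := hζ z (by simp)
    obtain ⟨n₃, h₃⟩ := hb z (by simp)
    rw [Finset.sum_insert hz]
    exact ⟨_, ((h₁.append h₂).append h₃).append hn⟩

theorem exists_closed_walks {S : Finset (ι → ℕ)} {J : ι → Prop} {N : ℕ} {e : ι → ℤ}
    (he : e ∈ AddSubmonoid.closure {e | ∃ m ≤ N, ∃ v, Walk A (S : Set (ι → ℕ)) J m v e v}) :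
    ∃ ζ : (ι → ℕ) → ι → ℤ, (∀ z ∈ S, ∃ n, Walk A (S : Set (ι → ℕ)) J n z (ζ z) z) ∧
      ∑ z ∈ S, ζ z = e := by
  classical
  induction he using AddSubmonoid.closure_induction with
  | mem e h =>
    obtain ⟨m, -, v, h⟩ := h
    refine ⟨fun z => if z = v then e else 0, fun z hz => ?_, ?_⟩
    · by_cases hzv : z = v
      · subst hzv
        exact ⟨m, by simpa using h⟩
      · exact ⟨0, by simpa [hzv] using Walk.nil (by exact_mod_cast hz)⟩
    · have hv : v ∈ S := by exact_mod_cast h.source_mem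
      simp [hv]
  | zero => exact ⟨0, fun z hz => ⟨0, Walk.nil (by exact_mod_cast hz)⟩, by simp⟩
  | add e e' _ _ ih ih' =>
    obtain ⟨ζ, h, rfl⟩ := ih
    obtain ⟨ζ', h', rfl⟩ := ih'
    refine ⟨ζ + ζ', fun z hz => ?_, by simp [Finset.sum_add_distrib]⟩
    obtain ⟨n, hn⟩ := h z hz
    obtain ⟨n', hn'⟩ := h' z hz
    exact ⟨_, hn.append hn'⟩

end Production

section Linearizable

variable {μ : Type*} {c : ι → ℕ} {f g : (μ → ℕ) →+ (ι → ℕ)}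

/-- A submonoid of a power of `ℕ` cut out by frozen coordinates, a finitely generated monoid of
displacements and the group generated by another submonoid is finitely generated. -/
theorem exists_fg_displacement [Finite μ] (f g : (μ → ℕ) →+ (ι → ℕ)) (J : ι → Prop)
    {C : AddSubmonoid (ι → ℤ)} (hC : C.FG) (T : AddSubmonoid (μ → ℕ)) :
    ∃ L : AddSubmonoid (μ → ℕ), L.FG ∧ ∀ l, l ∈ L ↔ (∀ i, J i → f l i = 0 ∧ g l i = 0) ∧
      (∃ e ∈ C, ∀ i, (g l i : ℤ) = f l i + e i) ∧ ∃ p ∈ T, ∃ q ∈ T, l + q = p := by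
  obtain ⟨n, h, rfl⟩ := AddSubmonoid.fg_iff_exists_fin_addMonoidHom.1 hC
  let Φ : AddSubmonoid ((μ → ℕ) × (Fin n → ℕ)) :=
    { carrier := {p | (∀ i, J i → f p.1 i = 0 ∧ g p.1 i = 0) ∧
        (∀ i, (g p.1 i : ℤ) = f p.1 i + h p.2 i) ∧ ∃ a ∈ T, ∃ b ∈ T, p.1 + b = a}
      zero_mem' := ⟨by simp, by simp, 0, zero_mem _, 0, zero_mem _, by simp⟩
      add_mem' := by
        rintro p p' ⟨h₁, h₂, a, ha, b, hb, h₃⟩ ⟨h₁', h₂', a', ha', b', hb', h₃'⟩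
        refine ⟨fun i hi => ?_, fun i => ?_, a + a', add_mem ha ha', b + b', add_mem hb hb', ?_⟩
        · simp [h₁ i hi, h₁' i hi]
        · simp only [Prod.fst_add, Prod.snd_add, map_add, Pi.add_apply, Nat.cast_add, h₂ i, h₂' i]
          ring
        · rw [← h₃, ← h₃', Prod.fst_add]
          abel }
  have hΦ : Φ.FG := by
    refine AddSubmonoid.fg_of_subtractive ?_
    rintro p ⟨h₁, h₂, a, ha, b, hb, h₃⟩ p' ⟨h₁', h₂', a', ha', b', hb', h₃'⟩
    refine ⟨fun i hi => ?_, fun i => ?_, a' + b, add_mem ha' hb, a + b', add_mem ha hb', ?_⟩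
    · have := h₁' i hi
      simp only [Prod.fst_add, map_add, Pi.add_apply] at this
      omega
    · have := h₂' i
      have := h₂ i
      simp only [Prod.fst_add, Prod.snd_add, map_add, Pi.add_apply, Nat.cast_add] at this h₂'
      have := h₂' i
      linarith
    · rw [← h₃, ← h₃', Prod.fst_add]
      abel
  refine ⟨Φ.map (AddMonoidHom.fst _ _), hΦ.map _, fun l => ⟨?_, ?_⟩⟩
  · rintro ⟨⟨l, m⟩, ⟨h₁, h₂, h₃⟩, rfl⟩
    exact ⟨h₁, ⟨h m, ⟨m, rfl⟩, h₂⟩, h₃⟩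
  · rintro ⟨h₁, ⟨_, ⟨m, rfl⟩, h₂⟩, h₃⟩
    exact ⟨(l, m), ⟨h₁, h₂, h₃⟩, rfl⟩

/-- The limit part of `linearizable_production`: the pumping argument. -/
theorem exists_nsmul_mem_production [Finite ι] {S : Finset (ι → ℕ)}
    (hS : (S : Set (ι → ℕ)) = restrict (Frozen A c f g) '' visited A c f g) :
    ∃ t ∈ production A c f g, ∀ (N : ℕ) (l : μ → ℕ),
      (∀ i, Frozen A c f g i → f l i = 0 ∧ g l i = 0) →
      (∃ e ∈ AddSubmonoid.closure
        {e | ∃ m ≤ N, ∃ v, Walk A (S : Set (ι → ℕ)) (Frozen A c f g) m v e v},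
        ∀ i, (g l i : ℤ) = f l i + e i) →
      ∃ k > 0, k • (t + l) ∈ production A c f g := by
  set J := Frozen A c f g with hJ
  have hres {l} (hl : l ∈ production A c f g) :
      restrict J (c + f l) = restrict J c ∧ restrict J (c + g l) = restrict J c := by
    constructor
    · refine restrict_congr fun i hi => ?_
      simp [hi _ (source_mem_intraproduction hl)]
    · refine restrict_congr fun i hi => ?_
      simp [hi _ (target_mem_intraproduction hl)]
  have hvis (z) : ∃ l ∈ production A c f g, ∃ a b : ι → ℤ, z ∈ S →
      (∃ n, Walk A (S : Set (ι → ℕ)) J n (restrict J c) a z) ∧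
      (∃ n, Walk A (S : Set (ι → ℕ)) J n z b (restrict J c)) ∧
      ∀ i, (g l i : ℤ) = f l i + (a + b) i := by
    by_cases hz : z ∈ S
    · obtain ⟨x, ⟨l, h₁, h₂⟩, rfl⟩ : z ∈ restrict J '' visited A c f g := by
        rw [← hS]
        exact_mod_cast hz
      have hl : l ∈ production A c f g := h₁.trans h₂
      have hw₁ := exists_walk (Reach.refl _) h₁ h₂
      have hw₂ := exists_walk h₁ h₂ (Reach.refl _)
      rw [← hS, ← hJ, (hres hl).1] at hw₁
      rw [← hS, ← hJ, (hres hl).2] at hw₂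
      refine ⟨l, hl, _, _, fun _ => ⟨hw₁, hw₂, fun i => ?_⟩⟩
      simp only [Pi.add_apply, Nat.cast_add]
      ring
    · exact ⟨0, zero_mem _, 0, 0, fun h => absurd h hz⟩
  choose l hl a b hab using hvis
  obtain ⟨q, ⟨lq, hq₁, hq₂⟩, hqpos⟩ :=
    exists_intraproduction_pos (A := A) (c := c) (f := f) (g := g)
  have hΛ : ∑ z ∈ S, l z ∈ production A c f g := sum_mem fun z _ => hl z
  refine ⟨lq + ∑ z ∈ S, l z, add_mem (hq₁.trans hq₂) hΛ, ?_⟩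
  rintro N l' hl' ⟨e, he, hle⟩
  obtain ⟨ζ, hζ, rfl⟩ := exists_closed_walks he
  have hroot : restrict J c ∈ (S : Set (ι → ℕ)) := by
    rw [hS]
    exact Set.mem_image_of_mem _ ⟨0, by simpa using Reach.refl c, by simpa using Reach.refl c⟩
  obtain ⟨n, hn⟩ := exists_tour hroot S (fun z hz => (hab z hz).1) (fun z hz => (hab z hz).2.1) hζ
  obtain ⟨K, hK⟩ := hn.lift
  have hgf : ∀ i, (g (∑ z ∈ S, l z + l') i : ℤ) = f (∑ z ∈ S, l z + l') i +
      (∑ z ∈ S, (a z + ζ z + b z)) i := by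
    intro i
    simp only [map_add, map_sum, Pi.add_apply, Finset.sum_apply, Nat.cast_add, Nat.cast_sum, hle i]
    rw [Finset.sum_congr rfl fun z hz => (hab z hz).2.2 i]
    simp only [Pi.add_apply, Finset.sum_add_distrib]
    ring
  have hloop : Reach A (c + (K + 1) • q + f (∑ z ∈ S, l z + l'))
      (c + (K + 1) • q + g (∑ z ∈ S, l z + l')) := by
    refine hK _ (fun i hi => ?_) (fun i hi => ?_) _ (fun i => ?_)
    · have h₁ : q i = 0 := hi q ⟨lq, hq₁, hq₂⟩
      have h₂ : f (∑ z ∈ S, l z) i = 0 := hi _ (source_mem_intraproduction hΛ)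
      have h₃ := (hl' i hi).1
      simp only [Pi.add_apply, Pi.smul_apply, map_add, restrict_apply hi, h₁, h₂, h₃]
      simp
    · have := hqpos i hi
      simp only [Pi.add_apply, Pi.smul_apply, smul_eq_mul]
      nlinarith
    · have := hgf i
      simp only [Pi.add_apply (c + (K + 1) • q), Nat.cast_add, this]
      ring
  refine ⟨K + 1, K.succ_pos, ?_⟩
  rw [mem_production, add_assoc]
  simp only [smul_add (K + 1) lq, map_add f, map_add g, map_nsmul]
  have h₁ := (hq₁.nsmul (K + 1)).add_right ((K + 1) • f (∑ z ∈ S, l z + l'))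
  have h₂ := hloop.nsmul (K + 1)
  have h₃ := (hq₂.nsmul (K + 1)).add_right ((K + 1) • g (∑ z ∈ S, l z + l'))
  have := (h₁.trans h₂).trans h₃
  simpa only [add_assoc, map_add, smul_add] using this

/-- Production submonoids are linearizable. -/
theorem linearizable_production [Finite ι] [Finite μ] (hA : A.Finite) (c : ι → ℕ)
    (f g : (μ → ℕ) →+ (ι → ℕ)) : Linearizable (production A c f g) := by
  obtain ⟨S, hS⟩ := (finite_restrict_visited (A := A) (c := c) (f := f) (g := g)).exists_finset_coe
  obtain ⟨t, ht, hlim⟩ := exists_nsmul_mem_production hS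
  have hfin : {e | ∃ m ≤ S.card, ∃ v,
      Walk A (S : Set (ι → ℕ)) (Frozen A c f g) m v e v}.Finite := by
    refine ((Set.finite_Iic S.card).biUnion fun m _ =>
      Walk.finite_effects (S := S) (J := Frozen A c f g) hA m).subset ?_
    rintro e ⟨m, hm, v, h⟩
    exact Set.mem_biUnion hm ⟨v, v, h⟩
  obtain ⟨L, hL, hmem⟩ := exists_fg_displacement f g (Frozen A c f g)
    ((AddSubmonoid.fg_iff _).2 ⟨_, rfl, hfin⟩) (production A c f g)
  refine ⟨L, hL, fun l hl => (hmem l).2 ⟨fun i hi => ⟨hi _ (source_mem_intraproduction hl),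
    hi _ (target_mem_intraproduction hl)⟩, ?_, l, hl, 0, zero_mem _, add_zero l⟩,
    fun l hl => ((hmem l).1 hl).2.2, t, ht, fun l hl => ?_⟩
  · obtain ⟨n, hn⟩ := exists_walk (Reach.refl _) (mem_production.1 hl) (Reach.refl _)
    rw [← hS, restrict_congr (y := c) fun i hi => by
      simp [hi _ (source_mem_intraproduction hl)], restrict_congr (x := c + g l) (y := c)
      fun i hi => by simp [hi _ (target_mem_intraproduction hl)]] at hn
    refine ⟨_, by simpa using hn.effect_mem_closure S.finite_toSet, fun i => ?_⟩
    ring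
  · obtain ⟨h₁, h₂, -⟩ := (hmem l).1 hl
    exact hlim _ l h₁ h₂

end Linearizable

end VAS

namespace VAS

variable {ι : Type*} {A : Set (ι → ℤ)} {u v w x y : ι → ℕ}

section Copies

variable {κ : Type*}

open Classical in
/-- The actions of `A` on one among `κ` copies of `ι`. -/
def copies (κ : Type*) (A : Set (ι → ℤ)) : Set (κ × ι → ℤ) :=
  ⋃ j : κ, (fun a p => if p.1 = j then a p.2 else 0) '' A

theorem finite_copies [Finite κ] (hA : A.Finite) : (copies κ A).Finite :=
  Set.finite_iUnion fun _ => hA.image _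

theorem reach_of_reach_copies {U V : κ × ι → ℕ} (h : Reach (copies κ A) U V) (j : κ) :
    Reach A (fun i => U (j, i)) (fun i => V (j, i)) := by
  induction h with
  | refl => exact Reach.refl _
  | @tail V W _ h ih =>
    refine ih.trans ?_
    obtain ⟨_, ⟨_, ⟨k, rfl⟩, a, ha, rfl⟩, h⟩ := h
    by_cases hk : j = k
    · exact Step.reach ⟨a, ha, fun i => by simpa [hk] using h (j, i)⟩
    · have : (fun i => W (j, i)) = fun i => V (j, i) := by
        ext i
        simpa [hk] using h (j, i)
      rw [this]
      exact Reach.refl _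

open Classical in
theorem Reach.copies_single (h : Reach A x y) (j : κ) (U : κ × ι → ℕ) :
    Reach (copies κ A) (fun p => if p.1 = j then x p.2 else U p)
      (fun p => if p.1 = j then y p.2 else U p) := by
  refine Relation.ReflTransGen.lift (fun x p => if p.1 = j then x p.2 else U p) ?_ _ _ h
  rintro x y ⟨a, ha, h⟩
  refine ⟨_, Set.mem_iUnion.2 ⟨j, a, ha, rfl⟩, fun p => ?_⟩
  by_cases hp : p.1 = j <;> simp [hp, h]

theorem reach_copies_iff [Finite κ] {U V : κ × ι → ℕ} :
    Reach (copies κ A) U V ↔ ∀ j, Reach A (fun i => U (j, i)) (fun i => V (j, i)) := by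
  classical
  refine ⟨reach_of_reach_copies, fun h => ?_⟩
  have := Fintype.ofFinite κ
  suffices H : ∀ s : Finset κ, Reach (copies κ A) U fun p => if p.1 ∈ s then V p else U p by
    simpa using H Finset.univ
  intro s
  induction s using Finset.induction_on with
  | empty => simpa using Reach.refl U
  | insert j s hj ih =>
    convert ih.trans (u := U) (w := fun p => if p.1 ∈ insert j s then V p else U p) ?_
    convert (h j).copies_single j (fun p => if p.1 ∈ s then V p else U p) using 1
    · ext ⟨k, i⟩
      by_cases hk : k = j
      · subst hk
        simp [hj]
      · simp [hk]
    · ext ⟨k, i⟩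
      by_cases hk : k = j
      · subst hk
        simp
      · simp [hk]

/-- Finite intersections of production submonoids are linearizable. -/
theorem linearizable_iInf_production {μ : Type*} [Finite ι] [Finite κ] [Finite μ] (hA : A.Finite)
    (c : κ → ι → ℕ) (f g : κ → (μ → ℕ) →+ (ι → ℕ)) :
    Linearizable (⨅ j, production A (c j) (f j) (g j)) := by
  let glue (f : κ → (μ → ℕ) →+ (ι → ℕ)) : (μ → ℕ) →+ (κ × ι → ℕ) :=
    { toFun := fun l p => f p.1 l p.2
      map_zero' := by ext; simp
      map_add' := by intros; ext; simp }
  convert linearizable_production (finite_copies (κ := κ) hA) (fun p => c p.1 p.2) (glue f)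
    (glue g)
  ext l
  rw [AddSubmonoid.mem_iInf, mem_production, reach_copies_iff]
  rfl

end Copies

/-- `Path A x w y`: the word `w` of configurations and actions is a run from `x` to `y`. -/
inductive Path (A : Set (ι → ℤ)) : (ι → ℕ) → List ((ι → ℕ) × A) → (ι → ℕ) → Prop
  | nil (c) : Path A c [] c
  | cons {c c' d w} (a : A) : (∀ i, (c' i : ℤ) = c i + (a : ι → ℤ) i) → Path A c' w d →
      Path A c ((c, a) :: w) d

theorem Path.reach {w} (h : Path A x w y) : Reach A x y := by
  induction h with
  | nil => exact Reach.refl _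
  | cons a h _ ih => exact (Step.reach ⟨a, a.2, h⟩).trans ih

theorem Reach.exists_path (h : Reach A x y) : ∃ w, Path A x w y := by
  induction h using Relation.ReflTransGen.head_induction_on with
  | refl => exact ⟨[], Path.nil _⟩
  | head h _ ih =>
    obtain ⟨w, hw⟩ := ih
    obtain ⟨a, ha, h⟩ := h
    exact ⟨_, Path.cons ⟨a, ha⟩ h hw⟩

/-- A pair `(r, s)` such that runs can be inserted in a run that visits the configurations `cs`,
so as to get a run whose source is larger by `r` and whose target is larger by `s`. -/
def Pump (A : Set (ι → ℤ)) : List (ι → ℕ) → (ι → ℕ) → (ι → ℕ) → Prop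
  | [], r, s => r = s
  | c :: cs, r, s => ∃ m, Reach A (c + r) (c + m) ∧ Pump A cs m s

theorem pump_iff {cs : List (ι → ℕ)} {r s : ι → ℕ} :
    Pump A cs r s ↔ ∃ m : ℕ → ι → ℕ, m 0 = r ∧ m cs.length = s ∧
      ∀ j : Fin cs.length, Reach A (cs.get j + m j) (cs.get j + m (j + 1)) := by
  induction cs generalizing r with
  | nil =>
    constructor
    · rintro rfl
      exact ⟨fun _ => r, rfl, rfl, fun j => j.elim0⟩
    · rintro ⟨m, rfl, h, -⟩
      exact h
  | cons c cs ih =>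
    constructor
    · rintro ⟨t, hr, ht⟩
      obtain ⟨m, rfl, rfl, h⟩ := ih.1 ht
      refine ⟨fun n => n.casesOn r m, rfl, rfl, fun j => ?_⟩
      induction j using Fin.cases with
      | zero => exact hr
      | succ j => exact h j
    · rintro ⟨m, rfl, rfl, h⟩
      exact ⟨m 1, h ⟨0, by simp⟩, ih.2 ⟨fun n => m (n + 1), rfl, rfl, fun j => h j.succ⟩⟩

/-- The configurations visited by a run. -/
def configs (w : List ((ι → ℕ) × A)) (y : ι → ℕ) : List (ι → ℕ) := w.map Prod.fst ++ [y]

theorem Path.reach_of_pump {w r s} (h : Path A x w y) (hp : Pump A (configs w y) r s) :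
    Reach A (x + r) (y + s) := by
  induction h generalizing r with
  | nil x =>
    obtain ⟨m, h, rfl⟩ := hp
    exact h
  | cons a h _ ih =>
    obtain ⟨m, h', hp⟩ := hp
    exact h'.trans (((Step.reach ⟨a, a.2, h⟩).add_right m).trans (ih hp))

/-- The relation between configurations paired with actions used to compare runs. -/
def LetterLE (p q : (ι → ℕ) × A) : Prop := p.1 ≤ q.1 ∧ p.2 = q.2

instance : IsPreorder ((ι → ℕ) × A) LetterLE where
  refl _ := ⟨le_rfl, rfl⟩
  trans _ _ _ h h' := ⟨h.1.trans h'.1, h.2.trans h'.2⟩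

theorem wellQuasiOrdered_letterLE [Finite ι] (hA : A.Finite) :
    WellQuasiOrdered (LetterLE (A := A)) := by
  have := hA.to_subtype
  exact (wellQuasiOrdered_le (α := ι → ℕ)).prod (Finite.wellQuasiOrdered (α := A) (· = ·))

theorem Path.pump {w w' r s} (h : Path A x w y) (hw : List.SublistForall₂ LetterLE w w')
    (hr : Reach A (x + r) u) (h' : Path A u w' (y + s)) : Pump A (configs w y) r s := by
  induction hw generalizing x u r with
  | nil =>
    cases h
    exact ⟨s, hr.trans h'.reach, rfl⟩
  | cons hab _ ih =>
    cases h with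
    | cons a h hw =>
      cases h' with
      | @cons _ v' _ _ a' h' hw' =>
        obtain ⟨hle, rfl⟩ := hab
        obtain ⟨m, rfl⟩ := exists_add_of_le hle
        refine ⟨m, hr, ih hw ?_ hw'⟩
        convert Reach.refl _ using 1
        ext i
        have h₁ := h i
        have h₂ := h' i
        simp only [Pi.add_apply, Nat.cast_add] at h₂ ⊢
        omega
  | cons_right _ ih =>
    cases h' with
    | cons a h' hw' => exact ih h (hr.trans (Step.reach ⟨a, a.2, h'⟩)) hw'

theorem exists_finite_basis {α : Type*} {r : α → α → Prop} (hr : WellQuasiOrdered r)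
    (s : Set α) : ∃ t ⊆ s, t.Finite ∧ ∀ y ∈ s, ∃ x ∈ t, r x y := by
  by_contra! h
  obtain ⟨f, hf, hf'⟩ := exists_seq_of_forall_finset_exists (· ∈ s) (fun x y => ¬ r x y)
    fun t ht => h t ht t.finite_toSet
  obtain ⟨m, n, hmn, h⟩ := hr f
  exact hf' m n hmn h

section Decomposition

variable {p q : ℕ} (f : (Fin p → ℕ) →+ (ι → ℕ)) (g : (Fin q → ℕ) →+ (ι → ℕ))

/-- The parametrization of the intermediate vectors of `Pump`. -/
def pumpHom (N j : ℕ) : (Fin p ⊕ Fin q ⊕ (Fin N × ι) → ℕ) →+ (ι → ℕ) :=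
  if j = 0 then f.comp
    { toFun := fun l k => l (.inl k), map_zero' := rfl, map_add' := fun _ _ => rfl }
  else if h : j < N then
    { toFun := fun l i => l (.inr (.inr (⟨j, h⟩, i))), map_zero' := rfl,
      map_add' := fun _ _ => rfl }
  else g.comp
    { toFun := fun l k => l (.inr (.inl k)), map_zero' := rfl, map_add' := fun _ _ => rfl }

theorem pumpHom_zero (N : ℕ) (l) : pumpHom f g N 0 l = f fun k => l (.inl k) := by
  simp [pumpHom]

theorem pumpHom_self {N : ℕ} (hN : N ≠ 0) (l) :
    pumpHom f g N N l = g fun k => l (.inr (.inl k)) := by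
  simp [pumpHom, hN]

theorem pumpHom_mid {N j : ℕ} (hj : j ≠ 0) (hjN : j < N) (l) (i : ι) :
    pumpHom f g N j l i = l (.inr (.inr (⟨j, hjN⟩, i))) := by
  simp [pumpHom, hj, hjN]

theorem exists_linearizable_pump [Finite ι] (hA : A.Finite) (cs : List (ι → ℕ)) (hcs : cs ≠ []) :
    ∃ P : AddSubmonoid (ι → ℕ), Linearizable P ∧
      ∀ s, s ∈ P ↔ ∃ k l, Pump A cs (f k) (g l) ∧ g l = s := by
  have hN : cs.length ≠ 0 := by simpa using hcs
  refine ⟨_, (linearizable_iInf_production hA cs.get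
    (fun j => pumpHom f g cs.length j) (fun j => pumpHom f g cs.length (j + 1))).map
      (pumpHom f g cs.length cs.length), fun s => ?_⟩
  rw [AddSubmonoid.mem_map]
  constructor
  · rintro ⟨l, hl, rfl⟩
    rw [AddSubmonoid.mem_iInf] at hl
    refine ⟨_, _, pump_iff.2 ⟨fun j => pumpHom f g cs.length j l, pumpHom_zero f g _ l,
      pumpHom_self f g hN l, hl⟩, (pumpHom_self f g hN l).symm⟩
  · rintro ⟨k, l, h, rfl⟩
    obtain ⟨m, h₀, h₁, h⟩ := pump_iff.1 h
    let L : Fin p ⊕ Fin q ⊕ (Fin cs.length × ι) → ℕ :=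
      Sum.elim k (Sum.elim l fun j => m j.1 j.2)
    have hL (j) (hj : j ≤ cs.length) : pumpHom f g cs.length j L = m j := by
      rcases eq_or_ne j 0 with rfl | hj₀
      · rw [pumpHom_zero, h₀]
        rfl
      · rcases hj.lt_or_eq with hj | rfl
        · ext i
          rw [pumpHom_mid f g hj₀ hj]
          rfl
        · rw [pumpHom_self f g hN, h₁]
          rfl
    refine ⟨L, ?_, by rw [hL _ le_rfl, h₁]⟩
    rw [AddSubmonoid.mem_iInf]
    intro j
    rw [mem_production, hL _ j.2.le, hL _ j.2]
    exact h j

open Pointwise in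
/-- The configurations of a linear set that are reachable from a linear set form a finite union of
shifted linearizable submonoids. -/
theorem exists_linearizable_decomposition [Finite ι] (hA : A.Finite) {X : Set (ι → ℕ)}
    (hX : IsLinearSet X) (b : ι → ℕ) {H : AddSubmonoid (ι → ℕ)} (hH : H.FG) :
    ∃ F : Set ((ι → ℕ) × AddSubmonoid (ι → ℕ)), F.Finite ∧
      (∀ P ∈ F, Linearizable P.2 ∧ P.2 ≤ H) ∧
      {y ∈ b +ᵥ (H : Set (ι → ℕ)) | ∃ x ∈ X, Reach A x y} =
        ⋃ P ∈ F, P.1 +ᵥ (P.2 : Set (ι → ℕ)) := by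
  obtain ⟨a, p, f, rfl⟩ := isLinearSet_iff_exists_fin_addMonoidHom.1 hX
  obtain ⟨q, g, rfl⟩ := AddSubmonoid.fg_iff_exists_fin_addMonoidHom.1 hH
  let Ω := (Fin p → ℕ) × (Fin q → ℕ) × List ((ι → ℕ) × A)
  let le (ω ω' : Ω) : Prop := ω.1 ≤ ω'.1 ∧ ω.2.1 ≤ ω'.2.1 ∧
    List.SublistForall₂ LetterLE ω.2.2 ω'.2.2
  have hwqo : WellQuasiOrdered le := by
    refine wellQuasiOrdered_le.prod (wellQuasiOrdered_le.prod ?_)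
    rw [← Set.partiallyWellOrderedOn_univ_iff]
    simpa using Set.PartiallyWellOrderedOn.partiallyWellOrderedOn_sublistForall₂ LetterLE
      (Set.partiallyWellOrderedOn_univ_iff.2 (wellQuasiOrdered_letterLE hA))
  obtain ⟨t, htΩ, ht, hbasis⟩ := exists_finite_basis hwqo
    {ω | Path A (a + f ω.1) ω.2.2 (b + g ω.2.1)}
  choose P hP hPmem using fun ω : Ω =>
    exists_linearizable_pump f g hA (configs ω.2.2 (b + g ω.2.1)) (by simp [configs])
  refine ⟨(fun ω => (b + g ω.2.1, P ω)) '' t, ht.image _, ?_, ?_⟩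
  · rintro _ ⟨ω, -, rfl⟩
    refine ⟨hP ω, fun s hs => ?_⟩
    obtain ⟨k, l, -, rfl⟩ := (hPmem ω s).1 hs
    exact ⟨l, rfl⟩
  · ext y
    simp only [Set.mem_iUnion, Set.mem_vadd_set, exists_prop,
      Set.mem_ofPred_eq, vadd_eq_add, SetLike.mem_coe]
    constructor
    · rintro ⟨⟨_, ⟨l, rfl⟩, rfl⟩, _, ⟨_, ⟨k, rfl⟩, rfl⟩, h⟩
      obtain ⟨w, hw⟩ := h.exists_path
      obtain ⟨⟨k₀, l₀, w₀⟩, hω, hk, hl, hw'⟩ := hbasis ⟨k, l, w⟩ hw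
      obtain ⟨k, rfl⟩ := exists_add_of_le hk
      obtain ⟨l, rfl⟩ := exists_add_of_le hl
      refine ⟨_, ⟨_, hω, rfl⟩, g l, (hPmem _ _).2 ⟨k, l, ?_, rfl⟩, by simp [add_assoc]⟩
      refine (htΩ hω).pump hw' (Reach.refl _) ?_
      simpa only [map_add, add_assoc, vadd_eq_add] using hw
    · rintro ⟨_, ⟨ω, hω, rfl⟩, s, hs, rfl⟩
      obtain ⟨k, l, h, rfl⟩ := (hPmem ω _).1 hs
      have := (htΩ hω).reach_of_pump h
      simp only [add_assoc, ← map_add] at this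
      exact ⟨⟨_, ⟨ω.2.1 + l, rfl⟩, by simp [add_assoc]⟩, _, ⟨_, ⟨ω.1 + k, rfl⟩, rfl⟩, by
        simpa [add_assoc] using this⟩

end Decomposition

end VAS

namespace VAS

open Pointwise

variable {ι : Type*}

/-- The dimension of the `ℚ`-vector space spanned by a submonoid of a power of `ℕ`. -/
noncomputable def rank (P : AddSubmonoid (ι → ℕ)) : ℕ :=
  Module.finrank ℚ (Submodule.span ℚ ((fun x i => (x i : ℚ)) '' (P : Set (ι → ℕ))))

section Rank

variable {K L M P Q : AddSubmonoid (ι → ℕ)}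

theorem exists_nsmul_add_eq_of_mem_span {x : ι → ℚ}
    (hx : x ∈ Submodule.span ℚ ((fun x i => (x i : ℚ)) '' (K : Set (ι → ℕ)))) :
    ∃ k : ℕ, 0 < k ∧ ∃ y ∈ K, ∃ z ∈ K, ∀ i, k * x i + y i = z i := by
  induction hx using Submodule.span_induction with
  | mem x hx =>
    obtain ⟨x, hx, rfl⟩ := hx
    exact ⟨1, one_pos, 0, zero_mem _, x, hx, fun i => by simp⟩
  | zero => exact ⟨1, one_pos, 0, zero_mem _, 0, zero_mem _, fun i => by simp⟩
  | add x x' _ _ ih ih' =>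
    obtain ⟨k, hk, y, hy, z, hz, h⟩ := ih
    obtain ⟨k', hk', y', hy', z', hz', h'⟩ := ih'
    refine ⟨k * k', by positivity, k' • y + k • y', add_mem (nsmul_mem hy _) (nsmul_mem hy' _),
      k' • z + k • z', add_mem (nsmul_mem hz _) (nsmul_mem hz' _), fun i => ?_⟩
    simp only [Pi.add_apply, Pi.smul_apply, smul_eq_mul, Nat.cast_add, Nat.cast_mul, ← h i,
      ← h' i]
    ring
  | smul r x _ ih =>
    obtain ⟨k, hk, y, hy, z, hz, h⟩ := ih
    have hr : r * r.den = r.num := Rat.mul_den_eq_num r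
    have hden := r.den_pos
    rcases Int.eq_nat_or_neg r.num with ⟨n, hn | hn⟩
    · refine ⟨r.den * k, by positivity, n • y, nsmul_mem hy _, n • z, nsmul_mem hz _,
        fun i => ?_⟩
      rw [hn, Int.cast_natCast] at hr
      simp only [Pi.smul_apply, smul_eq_mul, Nat.cast_mul, ← h i, ← hr]
      ring
    · refine ⟨r.den * k, by positivity, n • z, nsmul_mem hz _, n • y, nsmul_mem hy _,
        fun i => ?_⟩
      rw [hn, Int.cast_neg, Int.cast_natCast, eq_neg_iff_add_eq_zero, add_comm,
        ← eq_neg_iff_add_eq_zero] at hr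
      simp only [Pi.smul_apply, smul_eq_mul, Nat.cast_mul, ← h i, hr]
      ring

variable [Finite ι]

theorem rank_le_of_forall_mem_span (h : ∀ x ∈ P, (fun i => (x i : ℚ)) ∈
    Submodule.span ℚ ((fun x i => (x i : ℚ)) '' (Q : Set (ι → ℕ)))) : rank P ≤ rank Q := by
  refine Submodule.finrank_mono (Submodule.span_le.2 ?_)
  rintro _ ⟨x, hx, rfl⟩
  exact h x hx

theorem rank_mono (h : P ≤ Q) : rank P ≤ rank Q :=
  rank_le_of_forall_mem_span fun _ hx => Submodule.subset_span ⟨_, h hx, rfl⟩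

theorem IsLinearization.rank_le (h : IsLinearization P L) : rank L ≤ rank P := by
  refine rank_le_of_forall_mem_span fun x hx => ?_
  obtain ⟨p, hp, q, hq, rfl⟩ := h.2.2.1 x hx
  have : (fun i => (x i : ℚ)) = (fun i => ((x + q) i : ℚ)) - fun i => (q i : ℚ) := by
    ext i
    simp
  rw [this]
  exact sub_mem (Submodule.subset_span ⟨_, hp, rfl⟩) (Submodule.subset_span ⟨_, hq, rfl⟩)

theorem exists_nsmul_add_mem_of_rank_le (hKL : K ≤ L) (h : rank L ≤ rank K) {g : ι → ℕ}
    (hg : g ∈ L) : ∃ k > 0, ∃ y ∈ K, k • g + y ∈ K := by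
  have hspan := Submodule.eq_of_le_of_finrank_le
    (Submodule.span_mono (R := ℚ) (Set.image_mono (f := fun (x : ι → ℕ) i => (x i : ℚ)) hKL)) h
  have hg' : (fun i => (g i : ℚ)) ∈
      Submodule.span ℚ ((fun x i => (x i : ℚ)) '' (K : Set (ι → ℕ))) := by
    rw [hspan]
    exact Submodule.subset_span ⟨g, hg, rfl⟩
  obtain ⟨k, hk, y, hy, z, hz, h⟩ := exists_nsmul_add_eq_of_mem_span hg'
  refine ⟨k, hk, y, hy, ?_⟩
  convert hz
  ext i
  exact_mod_cast h i

end Rank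

/-- A finitely generated commutative monoid has an order unit. -/
theorem exists_order_unit {M : Type*} [AddCommMonoid M] {K : AddSubmonoid M} (hK : K.FG) :
    ∃ v ∈ K, ∀ y ∈ K, ∃ N > 0, ∃ z ∈ K, y + z = N • v := by
  classical
  obtain ⟨G, rfl⟩ := hK
  have hv : ∑ x ∈ G, x ∈ AddSubmonoid.closure (G : Set M) :=
    sum_mem fun x hx => AddSubmonoid.subset_closure hx
  refine ⟨_, hv, fun y hy => ?_⟩
  induction hy using AddSubmonoid.closure_induction with
  | mem y hy =>
    refine ⟨1, one_pos, ∑ x ∈ G.erase y, x, sum_mem fun x hx =>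
      AddSubmonoid.subset_closure (Finset.mem_of_mem_erase hx), ?_⟩
    rw [one_smul, Finset.add_sum_erase G (fun x => x) hy]
  | zero => exact ⟨1, one_pos, _, hv, by simp⟩
  | add y y' _ _ ih ih' =>
    obtain ⟨N, hN, z, hz, h⟩ := ih
    obtain ⟨N', -, z', hz', h'⟩ := ih'
    exact ⟨N + N', by positivity, z + z', add_mem hz hz', by rw [add_smul, ← h, ← h']; abel⟩

/-- If `v` is an order unit of a linearization of `P`, then it is an order unit of `P`. -/
theorem IsLinearization.exists_add_eq_nsmul {M : Type*} [AddCommMonoid M] {P L : AddSubmonoid M}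
    (h : IsLinearization P L) {v : M} (hv : ∀ g ∈ L, ∃ N > 0, ∃ z ∈ L, g + z = N • v) {p : M}
    (hp : p ∈ P) : ∃ N > 0, ∃ q ∈ P, p + q = N • v := by
  obtain ⟨-, hPL, -, t, ht, hlim⟩ := h
  obtain ⟨N, hN₀, z, hz, hN⟩ := hv (t + p) (hPL (add_mem ht hp))
  obtain ⟨k, hk, hmem⟩ := hlim z hz
  obtain ⟨k, rfl⟩ := Nat.exists_eq_succ_of_ne_zero hk.ne'
  refine ⟨(k + 1) * N, by positivity, _, add_mem hmem (nsmul_mem hp k), ?_⟩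
  rw [mul_smul, ← hN]
  simp only [smul_add, succ_nsmul]
  abel

theorem IsLinearization.exists_add_nsmul_mem {M : Type*} [AddCommMonoid M]
    {P L : AddSubmonoid M} (h : IsLinearization P L) {v : M}
    (hv : ∀ g ∈ L, ∃ N > 0, ∃ z ∈ L, g + z = N • v) {l : M} (hl : l ∈ L) :
    ∃ n > 0, ∀ j > 0, l + (n * j) • v ∈ P := by
  obtain ⟨p, hp, q, hq, hlq⟩ := h.2.2.1 l hl
  obtain ⟨n, hn, q', hq', hnv⟩ := h.exists_add_eq_nsmul hv hq
  have hmem : n • v ∈ P := hnv ▸ add_mem hq hq'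
  refine ⟨n, hn, fun j hj => ?_⟩
  obtain ⟨j, rfl⟩ := Nat.exists_eq_succ_of_ne_zero hj.ne'
  have : l + (n * (j + 1)) • v = p + q' + j • (n • v) := by
    rw [mul_comm, mul_smul, succ_nsmul, ← hlq]
    nth_rw 2 [← hnv]
    abel
  rw [this]
  exact add_mem (add_mem hp hq') (nsmul_mem hmem j)

/-- Linearizations of disjoint shifted submonoids that meet have an intersection of small rank. -/
theorem rank_inf_lt [Finite ι] {P Q L M : AddSubmonoid (ι → ℕ)} {b c : ι → ℕ} {r : ℕ}
    (hP : IsLinearization P L) (hQ : IsLinearization Q M) (hK : (L ⊓ M).FG)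
    (hdisj : Disjoint (b +ᵥ (P : Set (ι → ℕ))) (c +ᵥ (Q : Set (ι → ℕ))))
    (hmeet : ((b +ᵥ (L : Set (ι → ℕ))) ∩ (c +ᵥ (M : Set (ι → ℕ)))).Nonempty)
    (hL : rank L ≤ r) (hM : rank M ≤ r) : rank (L ⊓ M) < r := by
  by_contra! hr
  obtain ⟨v, -, hv⟩ := exists_order_unit hK
  have hunit {N : AddSubmonoid (ι → ℕ)} (hN : L ⊓ M ≤ N) (hrk : rank N ≤ r) (g) (hg : g ∈ N) :
      ∃ n > 0, ∃ z ∈ N, g + z = n • v := by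
    obtain ⟨k, hk, y, hy, hky⟩ := exists_nsmul_add_mem_of_rank_le hN (hrk.trans hr) hg
    obtain ⟨k, rfl⟩ := Nat.exists_eq_succ_of_ne_zero hk.ne'
    obtain ⟨n, hn, z, hz, h⟩ := hv _ hky
    refine ⟨n, hn, k • g + y + z, add_mem (add_mem (nsmul_mem hg _) (hN hy)) (hN hz), ?_⟩
    rw [← h, succ_nsmul]
    abel
  obtain ⟨z, ⟨l, hl, rfl⟩, ⟨m, hm, hlm⟩⟩ := hmeet
  obtain ⟨n, hn, h⟩ := hP.exists_add_nsmul_mem (hunit inf_le_left hL) hl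
  obtain ⟨n', hn', h'⟩ := hQ.exists_add_nsmul_mem (hunit inf_le_right hM) hm
  refine Set.disjoint_left.1 hdisj ⟨_, h n' hn', rfl⟩ ⟨_, h' n hn, ?_⟩
  simp only [vadd_eq_add] at hlm ⊢
  rw [← add_assoc, ← add_assoc, hlm, mul_comm]

/-- The intersection of two linear sets, with explicit periods. -/
theorem exists_finite_vadd_inter [Finite ι] {L M : AddSubmonoid (ι → ℕ)} (hL : L.FG)
    (hM : M.FG) (b c : ι → ℕ) : ∃ W : Set (ι → ℕ), W.Finite ∧
      (b +ᵥ (L : Set (ι → ℕ))) ∩ (c +ᵥ (M : Set (ι → ℕ))) =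
        ⋃ w ∈ W, w +ᵥ ((L ⊓ M : AddSubmonoid (ι → ℕ)) : Set (ι → ℕ)) := by
  obtain ⟨p, f, rfl⟩ := AddSubmonoid.fg_iff_exists_fin_addMonoidHom.1 hL
  obtain ⟨q, g, rfl⟩ := AddSubmonoid.fg_iff_exists_fin_addMonoidHom.1 hM
  obtain ⟨t, htΩ, ht, hbasis⟩ := exists_finite_basis
    (wellQuasiOrdered_le (α := (Fin p → ℕ) × (Fin q → ℕ))) {k | b + f k.1 = c + g k.2}
  refine ⟨(fun k => b + f k.1) '' t, ht.image _, ?_⟩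
  ext y
  simp only [Set.mem_inter_iff, Set.mem_iUnion, Set.mem_vadd_set, exists_prop, vadd_eq_add,
    SetLike.mem_coe]
  constructor
  · rintro ⟨⟨_, ⟨k, rfl⟩, rfl⟩, ⟨_, ⟨l, rfl⟩, h⟩⟩
    obtain ⟨⟨k₀, l₀⟩, hkl, hk, hl⟩ := hbasis (k, l) h.symm
    obtain ⟨k, rfl⟩ := exists_add_of_le hk
    obtain ⟨l, rfl⟩ := exists_add_of_le hl
    refine ⟨_, ⟨_, hkl, rfl⟩, f k, ⟨⟨k, rfl⟩, ⟨l, ?_⟩⟩, by simp [add_assoc]⟩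
    have h₀ : b + f k₀ = c + g l₀ := htΩ hkl
    simp only [map_add, ← add_assoc] at h
    rw [← h₀] at h
    exact add_left_cancel h
  · rintro ⟨_, ⟨⟨k₀, l₀⟩, hkl, rfl⟩, z, ⟨⟨k, rfl⟩, ⟨l, hl⟩⟩, rfl⟩
    have h₀ : b + f k₀ = c + g l₀ := htΩ hkl
    refine ⟨⟨_, ⟨k₀ + k, rfl⟩, by simp [add_assoc]⟩, ⟨_, ⟨l₀ + l, rfl⟩, ?_⟩⟩
    rw [map_add, ← add_assoc, ← h₀, hl]

theorem fg_inf [Finite ι] {L M : AddSubmonoid (ι → ℕ)} (hL : L.FG) (hM : M.FG) :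
    (L ⊓ M).FG := by
  obtain ⟨p, f, rfl⟩ := AddSubmonoid.fg_iff_exists_fin_addMonoidHom.1 hL
  obtain ⟨q, g, rfl⟩ := AddSubmonoid.fg_iff_exists_fin_addMonoidHom.1 hM
  have := (AddSubmonoid.fg_eqLocusM (f.comp (AddMonoidHom.fst _ (Fin q → ℕ)))
    (g.comp (AddMonoidHom.snd (Fin p → ℕ) _))).map (f.comp (AddMonoidHom.fst _ _))
  convert this
  ext x
  constructor
  · rintro ⟨⟨k, rfl⟩, ⟨l, h⟩⟩
    exact ⟨(k, l), h.symm, rfl⟩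
  · rintro ⟨⟨k, l⟩, h, rfl⟩
    exact ⟨⟨k, rfl⟩, ⟨l, Eq.symm h⟩⟩

/-- A finite union of linear sets of rank less than `r`. -/
def IsSmall (r : ℕ) (D : Set (ι → ℕ)) : Prop :=
  ∃ S : Set (Set (ι → ℕ)), S.Finite ∧ D = ⋃₀ S ∧
    ∀ T ∈ S, ∃ (b : ι → ℕ) (H : AddSubmonoid (ι → ℕ)), H.FG ∧ rank H < r ∧
      T = b +ᵥ (H : Set (ι → ℕ))

section IsSmall

variable {r : ℕ} {D X Y : Set (ι → ℕ)}

theorem IsSmall.biUnion {κ : Type*} {s : Set κ} {t : κ → Set (ι → ℕ)} (hs : s.Finite)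
    (h : ∀ k ∈ s, IsSmall r (t k)) : IsSmall r (⋃ k ∈ s, t k) := by
  choose! S hS hSt hSr using h
  refine ⟨⋃ k ∈ s, S k, hs.biUnion hS, ?_, ?_⟩
  · simp only [Set.sUnion_iUnion]
    exact Set.iUnion₂_congr hSt
  · intro T hT
    simp only [Set.mem_iUnion] at hT
    obtain ⟨k, hk, hT⟩ := hT
    exact hSr k hk T hT

theorem isSmall_vadd {b : ι → ℕ} {H : AddSubmonoid (ι → ℕ)} (hH : H.FG) (hr : rank H < r) :
    IsSmall r (b +ᵥ (H : Set (ι → ℕ))) :=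
  ⟨{b +ᵥ (H : Set (ι → ℕ))}, Set.finite_singleton _, by simp, by
    rintro _ rfl
    exact ⟨b, H, hH, hr, rfl⟩⟩

theorem isSmall_empty : IsSmall r (∅ : Set (ι → ℕ)) :=
  ⟨∅, Set.finite_empty, by simp, by simp⟩

theorem IsSmall.subset [Finite ι] (hD : IsSmall r D) (hX : IsSemilinearSet X) (h : X ⊆ D) :
    IsSmall r X := by
  obtain ⟨S, hS, rfl, hSr⟩ := hD
  obtain ⟨S', hS', hlin, rfl⟩ := hX
  have : ⋃₀ S' = ⋃ T ∈ S, ⋃ T' ∈ S', T' ∩ T := by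
    ext x
    constructor
    · intro hx
      obtain ⟨T, hT, hxT⟩ := h hx
      obtain ⟨T', hT', hxT'⟩ := hx
      simp only [Set.mem_iUnion]
      exact ⟨T, hT, T', hT', hxT', hxT⟩
    · intro hx
      simp only [Set.mem_iUnion] at hx
      obtain ⟨T, hT, T', hT', hxT', hxT⟩ := hx
      exact ⟨T', hT', hxT'⟩
  rw [this]
  refine IsSmall.biUnion hS fun T hT => IsSmall.biUnion hS' fun T' hT' => ?_
  obtain ⟨b, H, hH, hr, rfl⟩ := hSr T hT
  obtain ⟨c, K, hK, rfl⟩ := isLinearSet_iff_exists_fg_eq_vadd.1 (hlin T' hT')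
  obtain ⟨W, hW, h⟩ := exists_finite_vadd_inter hK hH c b
  rw [h]
  exact IsSmall.biUnion hW fun w _ => isSmall_vadd (fg_inf hK hH)
    ((rank_mono inf_le_right).trans_lt hr)

theorem isSmall_univ [Finite ι] : IsSmall (rank (⊤ : AddSubmonoid (ι → ℕ)) + 1)
    (Set.univ : Set (ι → ℕ)) := by
  convert isSmall_vadd (b := 0) (AddMonoid.FG.fg_top (M := ι → ℕ)) (Nat.lt_succ_self _)
  simp

theorem IsSmall.eq_empty (h : IsSmall 0 D) : D = ∅ := by
  obtain ⟨S, -, rfl, h⟩ := h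
  refine Set.sUnion_eq_empty.2 fun T hT => ?_
  obtain ⟨_, _, _, h, _⟩ := h T hT
  simp at h

end IsSmall

variable {A : Set (ι → ℤ)}

/-- The part of a small set that is reachable from a semilinear set. -/
theorem IsSmall.exists_reach_decomposition [Finite ι] (hA : A.Finite) {r : ℕ}
    {X D : Set (ι → ℕ)} (hX : IsSemilinearSet X) (hD : IsSmall (r + 1) D) :
    ∃ F : Set ((ι → ℕ) × AddSubmonoid (ι → ℕ)), F.Finite ∧
      (∀ P ∈ F, Linearizable P.2 ∧ rank P.2 ≤ r) ∧
      {y ∈ D | ∃ x ∈ X, Reach A x y} = ⋃ P ∈ F, P.1 +ᵥ (P.2 : Set (ι → ℕ)) := by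
  obtain ⟨S, hS, hlin, rfl⟩ := hX
  obtain ⟨S', hS', rfl, hsmall⟩ := hD
  have h (T T') (hT : T ∈ S) (hT' : T' ∈ S') :
      ∃ F : Set ((ι → ℕ) × AddSubmonoid (ι → ℕ)), F.Finite ∧
        (∀ P ∈ F, Linearizable P.2 ∧ rank P.2 ≤ r) ∧
        {y ∈ T' | ∃ x ∈ T, Reach A x y} = ⋃ P ∈ F, P.1 +ᵥ (P.2 : Set (ι → ℕ)) := by
    obtain ⟨b, H, hH, hr, rfl⟩ := hsmall T' hT'
    obtain ⟨F, hF, hlin, h⟩ := exists_linearizable_decomposition hA (hlin T hT) b hH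
    exact ⟨F, hF, fun P hP => ⟨(hlin P hP).1,
      (rank_mono (hlin P hP).2).trans (Nat.lt_succ_iff.1 hr)⟩, h⟩
  choose! F hF hFlin hFeq using h
  refine ⟨⋃ T ∈ S, ⋃ T' ∈ S', F T T',
    hS.biUnion fun T hT => hS'.biUnion fun T' hT' => hF T T' hT hT', ?_, ?_⟩
  · intro P hP
    simp only [Set.mem_iUnion] at hP
    obtain ⟨T, hT, T', hT', hP⟩ := hP
    exact hFlin T T' hT hT' P hP
  · ext y
    have hy (T) (hT : T ∈ S) (T') (hT' : T' ∈ S') := Set.ext_iff.1 (hFeq T T' hT hT') y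
    simp only [Set.mem_iUnion, Set.mem_ofPred_eq, Set.mem_sUnion, exists_prop] at hy ⊢
    constructor
    · rintro ⟨⟨T', hT', hyT'⟩, x, ⟨T, hT, hx⟩, h⟩
      obtain ⟨P, hP, hyP⟩ := (hy T hT T' hT').1 ⟨hyT', x, hx, h⟩
      exact ⟨P, ⟨T, hT, T', hT', hP⟩, hyP⟩
    · rintro ⟨P, ⟨T, hT, T', hT', hP⟩, hyP⟩
      obtain ⟨hyT', x, hx, h⟩ := (hy T hT T' hT').2 ⟨P, hP, hyP⟩
      exact ⟨⟨T', hT', hyT'⟩, x, ⟨T, hT, hx⟩, h⟩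

/-- A semilinear over-approximation of the part of a small set reachable from a semilinear set. -/
theorem exists_linearization_decomposition [Finite ι] (hA : A.Finite) {r : ℕ}
    {X D : Set (ι → ℕ)} (hX : IsSemilinearSet X) (hD : IsSmall (r + 1) D) :
    ∃ (F : Set ((ι → ℕ) × AddSubmonoid (ι → ℕ)))
      (L : (ι → ℕ) × AddSubmonoid (ι → ℕ) → AddSubmonoid (ι → ℕ)), F.Finite ∧
      (∀ P ∈ F, IsLinearization P.2 (L P) ∧ rank (L P) ≤ r ∧
        ∀ y ∈ P.1 +ᵥ (P.2 : Set (ι → ℕ)), ∃ x ∈ X, Reach A x y) ∧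
      (∀ y ∈ D, (∃ x ∈ X, Reach A x y) → y ∈ ⋃ P ∈ F, P.1 +ᵥ (L P : Set (ι → ℕ))) ∧
      IsSemilinearSet (⋃ P ∈ F, P.1 +ᵥ (L P : Set (ι → ℕ))) := by
  obtain ⟨F, hF, hlin, h⟩ := hD.exists_reach_decomposition hA hX
  choose! L hL using fun P hP => (hlin P hP).1
  refine ⟨F, L, hF, fun P hP => ⟨hL P hP, (hL P hP).rank_le.trans (hlin P hP).2, ?_⟩, ?_, ?_⟩
  · intro y hy
    have : y ∈ ⋃ P ∈ F, P.1 +ᵥ (P.2 : Set (ι → ℕ)) := Set.mem_biUnion hP hy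
    rw [← h] at this
    exact this.2
  · intro y hyD hy
    have : y ∈ ⋃ P ∈ F, P.1 +ᵥ (P.2 : Set (ι → ℕ)) := h ▸ ⟨hyD, hy⟩
    simp only [Set.mem_iUnion] at this ⊢
    obtain ⟨P, hP, z, hz, rfl⟩ := this
    exact ⟨P, hP, z, (hL P hP).2.1 hz, rfl⟩
  · exact IsSemilinearSet.biUnion hF fun P hP =>
      (isLinearSet_iff_exists_fg_eq_vadd.2 ⟨P.1, L P, (hL P hP).1, rfl⟩).isSemilinearSet

theorem exists_semilinear_invariant_of_isSmall [Finite ι] (hA : A.Finite) (r : ℕ)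
    {X Y : Set (ι → ℕ)} (hX : IsSemilinearSet X) (hY : IsSemilinearSet Y)
    (hXY : ∀ x ∈ X, ∀ y ∈ Y, ¬ Reach A x y) (hr : IsSmall r (X ∪ Y)ᶜ) :
    ∃ S : Set (ι → ℕ), IsSemilinearSet S ∧ X ⊆ S ∧ Disjoint S Y ∧
      ∀ u ∈ S, ∀ v, Step A u v → v ∈ S := by
  induction r generalizing X Y with
  | zero =>
    have hunion : X ∪ Y = Set.univ := Set.compl_empty_iff.1 hr.eq_empty
    refine ⟨X, hX, subset_rfl, Set.disjoint_left.2 fun x hx hy => hXY x hx x hy (Reach.refl x),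
      fun u hu v huv => ?_⟩
    have hv : v ∈ X ∪ Y := hunion ▸ Set.mem_univ v
    exact hv.resolve_right fun hv => hXY u hu v hv huv.reach
  | succ r ih =>
    set D := (X ∪ Y)ᶜ with hD
    have hDs : IsSemilinearSet D := (hX.union hY).compl
    obtain ⟨F, L, hF, hFP, hFD, hS⟩ := exists_linearization_decomposition hA hX hr
    set S := ⋃ P ∈ F, P.1 +ᵥ (L P : Set (ι → ℕ))
    have hY' : IsSemilinearSet (Y ∪ D \ S) := hY.union (hDs.sdiff hS)
    have hXY' : ∀ x ∈ X, ∀ y ∈ Y ∪ D \ S, ¬ Reach A x y := by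
      rintro x hx y (hy | ⟨hy, hyS⟩) h
      · exact hXY x hx y hy h
      · exact hyS (hFD y hy ⟨x, hx, h⟩)
    have hDS : IsSemilinearSet (D ∩ S) := hDs.inter hS
    obtain ⟨G, M, hG, hGP, hGD, hT⟩ := exists_linearization_decomposition (A := -A) hA.neg hY'
      (hr.subset hDS Set.inter_subset_left)
    set T := ⋃ P ∈ G, P.1 +ᵥ (M P : Set (ι → ℕ))
    suffices h : (∀ x ∈ X ∪ (D ∩ S) \ T, ∀ y ∈ Y ∪ D \ S, ¬ Reach A x y) ∧
        IsSmall r (X ∪ (D ∩ S) \ T ∪ (Y ∪ D \ S))ᶜ by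
      obtain ⟨I, hI, hXI, hYI, hinv⟩ := ih (hX.union (hDS.sdiff hT)) hY' h.1 h.2
      exact ⟨I, hI, Set.subset_union_left.trans hXI, hYI.mono_right Set.subset_union_left, hinv⟩
    constructor
    · rintro x (hx | ⟨hx, hxT⟩) y hy h
      · exact hXY' x hx y hy h
      · exact hxT (hGD x hx ⟨y, hy, reach_neg.2 h⟩)
    · have hST : IsSmall r (⋃ P ∈ F, ⋃ Q ∈ G,
          (P.1 +ᵥ (L P : Set (ι → ℕ))) ∩ (Q.1 +ᵥ (M Q : Set (ι → ℕ)))) := by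
        refine IsSmall.biUnion hF fun P hP => IsSmall.biUnion hG fun Q hQ => ?_
        obtain ⟨hPL, hPr, hPX⟩ := hFP P hP
        obtain ⟨hQM, hQr, hQY⟩ := hGP Q hQ
        rcases Set.eq_empty_or_nonempty
          ((P.1 +ᵥ (L P : Set (ι → ℕ))) ∩ (Q.1 +ᵥ (M Q : Set (ι → ℕ)))) with h | h
        · rw [h]
          exact isSmall_empty
        · have hfg := fg_inf hPL.1 hQM.1
          have hlt := rank_inf_lt hPL hQM hfg (Set.disjoint_left.2 fun z hz hz' => by
            obtain ⟨x, hx, hxz⟩ := hPX z hz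
            obtain ⟨y, hy, hyz⟩ := hQY z hz'
            exact hXY' x hx y hy (hxz.trans (reach_neg.1 hyz))) h hPr hQr
          obtain ⟨W, hW, h⟩ := exists_finite_vadd_inter hPL.1 hQM.1 P.1 Q.1
          rw [h]
          exact IsSmall.biUnion hW fun w _ => isSmall_vadd hfg hlt
      refine hST.subset ((hX.union (hDS.sdiff hT)).union hY').compl fun z hz => ?_
      simp only [Set.mem_compl_iff, Set.mem_union, Set.mem_sdiff, Set.mem_inter_iff, not_or,
        not_and, not_not] at hz
      obtain ⟨⟨hzX, hzT⟩, hzY, hzS⟩ := hz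
      have hzD : z ∈ D := by
        rw [hD, Set.mem_compl_iff, Set.mem_union]
        tauto
      have h₁ := hzS hzD
      have h₂ := hzT ⟨hzD, h₁⟩
      simp only [S, T, Set.mem_iUnion, Set.mem_inter_iff] at h₁ h₂ ⊢
      obtain ⟨P, hP, h₁⟩ := h₁
      obtain ⟨Q, hQ, h₂⟩ := h₂
      exact ⟨P, hP, Q, hQ, h₁, h₂⟩

/-- Unreachability is witnessed by semilinear inductive invariants. -/
theorem exists_semilinear_invariant [Finite ι] (hA : A.Finite) {x y : ι → ℕ}
    (h : ¬ Reach A x y) : ∃ S : Set (ι → ℕ), IsSemilinearSet S ∧ x ∈ S ∧ y ∉ S ∧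
      ∀ u ∈ S, ∀ v, Step A u v → v ∈ S := by
  have hx := IsSemilinearSet.singleton x
  have hy := IsSemilinearSet.singleton y
  obtain ⟨S, hS, hxS, hyS, hinv⟩ := exists_semilinear_invariant_of_isSmall hA _ hx hy
    (by simpa using h) (isSmall_univ.subset (hx.union hy).compl (Set.subset_univ _))
  exact ⟨S, hS, hxS rfl, fun hy => Set.disjoint_left.1 hyS hy rfl, hinv⟩

end VAS

namespace VAS

open Pointwise

variable {ι : Type*} [Finite ι]

/-- The quotients of linear sets by residue classes modulo `2` are unions of sets from a finite
family. -/
theorem exists_finite_quotients_of_isLinearSet {S : Set (ι → ℕ)} (hS : IsLinearSet S) :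
    ∃ B : Set (Set (ι → ℕ)), B.Finite ∧ S ∈ B ∧
      ∀ U ∈ B, ∀ e ≤ (1 : ι → ℕ), ∃ T ⊆ B, {u | 2 • u + e ∈ U} = ⋃₀ T := by
  classical
  have := Fintype.ofFinite ι
  obtain ⟨a, n, f, rfl⟩ := isLinearSet_iff_exists_fin_addMonoidHom.1 hS
  set b := f 1 + a + 1 with hb
  let U (p : (ι → ℕ) × (ι → ℕ)) : Set (ι → ℕ) := {u | ∃ k, u + p.1 = f k + p.2}
  refine ⟨U '' (Set.Iic b ×ˢ Set.Iic b), ((Set.finite_Iic b).prod (Set.finite_Iic b)).image U,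
    ⟨(0, a), ⟨Set.mem_Iic.2 zero_le, ?_⟩, ?_⟩, ?_⟩
  · exact fun i => by simp only [hb, Pi.add_apply, Pi.one_apply]; omega
  · ext u
    simp [U, Set.mem_vadd_set, eq_comm, add_comm]
  rintro _ ⟨⟨m, m'⟩, ⟨hm, hm'⟩, rfl⟩ e he
  have hf {ε : Fin n → ℕ} (hε : ε ≤ 1) : f ε ≤ f 1 := by
    rw [← add_tsub_cancel_of_le hε, map_add]
    exact le_self_add
  refine ⟨{V | ∃ ε ≤ (1 : Fin n → ℕ), (∀ i, (e i + m i) % 2 = (f ε i + m' i) % 2) ∧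
    V = U (fun i => (e i + m i) / 2, fun i => (f ε i + m' i) / 2)}, ?_, ?_⟩
  · rintro _ ⟨ε, hε, -, rfl⟩
    refine ⟨_, ⟨fun i => ?_, fun i => ?_⟩, rfl⟩
    · have h₁ := he i
      have h₂ := hm i
      simp only [hb, Pi.add_apply, Pi.one_apply] at h₁ h₂ ⊢
      omega
    · have h₁ := hf hε i
      have h₂ := hm' i
      simp only [hb, Pi.add_apply, Pi.one_apply] at h₁ h₂ ⊢
      omega
  · ext u
    simp only [Set.mem_ofPred_eq, Set.mem_sUnion, U]
    constructor
    · rintro ⟨k, hk⟩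
      have hk' : k = 2 • (fun i => k i / 2) + fun i => k i % 2 := by
        ext i
        simp only [Pi.add_apply, Pi.smul_apply, smul_eq_mul]
        omega
      rw [hk', map_add, map_nsmul] at hk
      refine ⟨_, ⟨fun i => k i % 2, fun i => ?_, fun i => ?_, rfl⟩, fun i => k i / 2, ?_⟩
      · simp only [Pi.one_apply]
        omega
      · have := congrFun hk i
        simp only [Pi.add_apply, Pi.smul_apply, smul_eq_mul] at this
        omega
      · ext i
        have := congrFun hk i
        simp only [Pi.add_apply, Pi.smul_apply, smul_eq_mul] at this ⊢
        omega
    · rintro ⟨_, ⟨ε, hε, hpar, rfl⟩, k, hk⟩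
      refine ⟨2 • k + ε, ?_⟩
      ext i
      have := congrFun hk i
      have := hpar i
      simp only [map_add, map_nsmul, Pi.add_apply, Pi.smul_apply, smul_eq_mul] at *
      omega

/-- A semilinear set has finitely many iterated quotients by residue classes modulo `2`. -/
theorem exists_finite_kernel {S : Set (ι → ℕ)} (hS : IsSemilinearSet S) :
    ∃ K : Set (Set (ι → ℕ)), K.Finite ∧ S ∈ K ∧
      ∀ U ∈ K, ∀ e ≤ (1 : ι → ℕ), {u | 2 • u + e ∈ U} ∈ K := by
  obtain ⟨R, hR, hlin, rfl⟩ := hS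
  choose! B hB hRB hBq using fun T hT => exists_finite_quotients_of_isLinearSet (hlin T hT)
  refine ⟨Set.sUnion '' 𝒫 (⋃ T ∈ R, B T), (hR.biUnion hB).powerset.image _,
    ⟨R, fun T hT => Set.mem_biUnion hT (hRB T hT), rfl⟩, ?_⟩
  rintro _ ⟨V, hV, rfl⟩ e he
  have hq (U) (hU : U ∈ V) : ∃ T ⊆ ⋃ T ∈ R, B T, {u | 2 • u + e ∈ U} = ⋃₀ T := by
    have := hV hU
    simp only [Set.mem_iUnion] at this
    obtain ⟨T, hT, hUT⟩ := this
    obtain ⟨Q, hQ, h⟩ := hBq T hT U hUT e he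
    exact ⟨Q, hQ.trans (Set.subset_biUnion_of_mem hT), h⟩
  choose! Q hQ hUQ using hq
  refine ⟨⋃ U ∈ V, Q U, Set.iUnion₂_subset hQ, ?_⟩
  simp only [Set.sUnion_iUnion]
  rw [← Set.iUnion₂_congr hUQ]
  ext u
  simp
end VAS

namespace VAS

section Primrec

variable {α β σ : Type*} [Primcodable α] [Primcodable β] [Primcodable σ]

theorem primrec_fst {f : α → β × σ} (hf : Primrec f) : Primrec fun a => (f a).1 :=
  Primrec.fst.comp hf

theorem primrec_snd {f : α → β × σ} (hf : Primrec f) : Primrec fun a => (f a).2 :=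
  Primrec.snd.comp hf

theorem primrecPred_imp {p q : α → Prop} (hp : PrimrecPred p) (hq : PrimrecPred q) :
    PrimrecPred fun a => p a → q a :=
  (hp.not.or hq).of_eq fun _ => imp_iff_not_or.symm

theorem primrecPred_eq {f g : α → β} (hf : Primrec f) (hg : Primrec g) :
    PrimrecPred fun a => f a = g a :=
  Primrec.eq.comp hf hg

theorem primrecPred_lt {f g : α → ℕ} (hf : Primrec f) (hg : Primrec g) :
    PrimrecPred fun a => f a < g a :=
  Primrec.nat_lt.comp hf hg

theorem primrecPred_exists_mem {f : α → List β} {R : α → β → Prop} (hf : Primrec f)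
    (hR : PrimrecPred fun p : α × β => R p.1 p.2) : PrimrecPred fun a => ∃ b ∈ f a, R a b :=
  (PrimrecRel.exists_mem_list (R := fun b a => R a b)
    (hR.comp (Primrec.snd.pair Primrec.fst))).comp hf Primrec.id

theorem primrecPred_forall_mem {f : α → List β} {R : α → β → Prop} (hf : Primrec f)
    (hR : PrimrecPred fun p : α × β => R p.1 p.2) : PrimrecPred fun a => ∀ b ∈ f a, R a b :=
  (PrimrecRel.forall_mem_list (R := fun b a => R a b)
    (hR.comp (Primrec.snd.pair Primrec.fst))).comp hf Primrec.id

theorem primrecPred_mem {f : α → β} {g : α → List β} (hf : Primrec f) (hg : Primrec g) :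
    PrimrecPred fun a => f a ∈ g a :=
  (primrecPred_exists_mem (R := fun a b => b = f a) hg
    (primrecPred_eq Primrec.snd (hf.comp Primrec.fst))).of_eq fun _ => exists_eq_right

theorem primrec_add {d : ℕ} {f g : α → Fin d → ℕ} (hf : Primrec f) (hg : Primrec g) :
    Primrec fun a => f a + g a :=
  Primrec.fin_curry.2 <| Primrec.nat_add.comp (Primrec.fin_app.comp (hf.comp Primrec.fst)
    Primrec.snd) (Primrec.fin_app.comp (hg.comp Primrec.fst) Primrec.snd)

theorem primrec_div_two {d : ℕ} {f : α → Fin d → ℕ} (hf : Primrec f) :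
    Primrec fun a => f a / 2 :=
  Primrec.fin_curry.2 <| Primrec.nat_div.comp (Primrec.fin_app.comp (hf.comp Primrec.fst)
    Primrec.snd) (Primrec.const 2)

theorem primrec_mod_two {d : ℕ} {f : α → Fin d → ℕ} (hf : Primrec f) :
    Primrec fun a i => f a i % 2 :=
  Primrec.fin_curry.2 <| Primrec.nat_mod.comp (Primrec.fin_app.comp (hf.comp Primrec.fst)
    Primrec.snd) (Primrec.const 2)

/-- Projections of primitive recursive relations are recursively enumerable. -/
theorem rePred_exists {R : α → σ → Prop} (hR : PrimrecPred fun p : α × σ => R p.1 p.2) :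
    REPred fun a => ∃ c, R a c := by
  classical
  have h : Primrec fun p : α × ℕ =>
      Option.casesOn (motive := fun _ => Bool) (Encodable.decode (α := σ) p.2) false
        fun c => decide (R p.1 c) :=
    Primrec.option_casesOn (Primrec.decode.comp Primrec.snd) (Primrec.const false)
      (hR.decide.comp (Primrec.pair (Primrec.fst.comp Primrec.fst) Primrec.snd))
  have h' : Partrec fun a => Nat.rfind fun n => Part.some
      (Option.casesOn (motive := fun _ => Bool) (Encodable.decode (α := σ) n) false
        fun c => decide (R a c)) :=
    Partrec.rfind h.to_comp.partrec
  refine h'.dom_re.of_eq fun a => ?_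
  trans ∃ n, Option.casesOn (motive := fun _ => Bool) (Encodable.decode (α := σ) n) false
    (fun c => decide (R a c)) = true
  · exact exists_congr fun n => ⟨fun h => (Part.mem_some_iff.1 h.1).symm,
      fun h => ⟨Part.mem_some_iff.2 h.symm, fun _ _ => trivial⟩⟩
  constructor
  · rintro ⟨n, hn⟩
    cases hc : Encodable.decode (α := σ) n with
    | none => simp [hc] at hn
    | some c => exact ⟨c, by simpa [hc] using hn⟩
  · rintro ⟨c, hc⟩
    exact ⟨Encodable.encode c, by simpa using hc⟩

end Primrec

theorem exists_list_step_iff {ι : Type*} {A : Set (ι → ℤ)} (hA : A.Finite) :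
    ∃ l : List ((ι → ℕ) × (ι → ℕ)), ∀ u v, Step A u v ↔ ∃ p ∈ l, v + p.1 = u + p.2 := by
  classical
  refine ⟨hA.toFinset.toList.map fun a => (fun i => (-a i).toNat, fun i => (a i).toNat),
    fun u v => ?_⟩
  constructor
  · rintro ⟨a, ha, h⟩
    refine ⟨_, List.mem_map_of_mem (Finset.mem_toList.2 (hA.mem_toFinset.2 ha)), funext fun i => ?_⟩
    have := h i
    simp only [Pi.add_apply]
    omega
  · rintro ⟨p, hp, h⟩
    obtain ⟨a, ha, rfl⟩ := List.mem_map.1 hp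
    refine ⟨a, hA.mem_toFinset.1 (Finset.mem_toList.1 ha), fun i => ?_⟩
    have := congrFun h i
    simp only [Pi.add_apply] at this
    omega

section Reachability

variable {ι : Type*} {A : Set (ι → ℤ)} {l : List ((ι → ℕ) × (ι → ℕ))} {x y : ι → ℕ}

/-- `W` lists configurations, with ranks, each of which is `x` or has a predecessor in `W` of
smaller rank; moreover `y` is listed. -/
def IsReachCertificate (l : List ((ι → ℕ) × (ι → ℕ))) (x y : ι → ℕ) (W : List ((ι → ℕ) × ℕ)) :
    Prop :=
  (∃ w ∈ W, w.1 = y) ∧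
    ∀ w ∈ W, w.1 = x ∨ ∃ w' ∈ W, w'.2 < w.2 ∧ ∃ p ∈ l, w.1 + p.1 = w'.1 + p.2

theorem reach_iff_exists_certificate (hl : ∀ u v, Step A u v ↔ ∃ p ∈ l, v + p.1 = u + p.2) :
    Reach A x y ↔ ∃ W, IsReachCertificate l x y W := by
  constructor
  · intro h
    induction h with
    | refl => exact ⟨[(x, 0)], by simp, by simp⟩
    | @tail u v _ huv ih =>
      obtain ⟨W, ⟨w, hw, rfl⟩, hW⟩ := ih
      refine ⟨(v, w.2 + 1) :: W, ⟨_, List.mem_cons_self, rfl⟩, fun w' hw' => ?_⟩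
      rcases List.mem_cons.1 hw' with rfl | hw'
      · exact Or.inr ⟨w, List.mem_cons_of_mem _ hw, Nat.lt_succ_self _, (hl _ _).1 huv⟩
      · exact (hW w' hw').imp_right fun ⟨w, hw, h⟩ => ⟨w, List.mem_cons_of_mem _ hw, h⟩
  · rintro ⟨W, ⟨w, hw, rfl⟩, hW⟩
    induction hn : w.2 using Nat.strong_induction_on generalizing w with
    | _ n ih =>
      subst hn
      rcases hW w hw with h | ⟨w', hw', hlt, h⟩
      · rw [h]
        exact Reach.refl x
      · exact (ih _ hlt w' hw' rfl).trans ((hl _ _).2 h).reach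

end Reachability

section Invariant

/-- The vectors accepted by the automaton with transitions `T` and accepting states `F`, which
reads binary expansions starting with the least significant digits. -/
inductive Accepts {ι : Type*} (T : List (ℕ × (ι → ℕ) × ℕ)) (F : List ℕ) : ℕ → (ι → ℕ) → Prop
  | zero {q : ℕ} (hq : q ∈ F) : Accepts T F q 0
  | step {q r : ℕ} {e u : ι → ℕ} (he : (q, e, r) ∈ T) (hu : Accepts T F r u) :
    Accepts T F q (2 • u + e)

variable {d : ℕ} {A : Set (Fin d → ℤ)} {l : List ((Fin d → ℕ) × (Fin d → ℕ))} {x y : Fin d → ℕ}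

/-- `T` and `F` are the transitions and the accepting states of an automaton, and the elements
`(q, q', m, n)` of `C` stand for the claims that `v` is accepted from `q'` whenever `u` is accepted
from `q` and `v + m = u + n`. -/
def IsSimulation (T : List (ℕ × (Fin d → ℕ) × ℕ)) (F : List ℕ)
    (C : List (ℕ × ℕ × (Fin d → ℕ) × (Fin d → ℕ))) : Prop :=
  (∀ t ∈ T, t.2.1 = 0 → t.2.2 ∈ F → t.1 ∈ F) ∧
  (∀ q ∈ F, ∃ t ∈ T, t.1 = q ∧ t.2.1 = 0 ∧ t.2.2 ∈ F) ∧
  (∀ c ∈ C, c.1 ∈ F → c.2.2.1 = c.2.2.2 → c.2.1 ∈ F) ∧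
  ∀ c ∈ C, ∀ t ∈ T, t.1 = c.1 → ∀ e ∈ (Finset.Iic (1 : Fin d → ℕ)).toList,
    (fun i => (e + c.2.2.1) i % 2) = (fun i => (t.2.1 + c.2.2.2) i % 2) →
    ∃ t' ∈ T, t'.1 = c.2.1 ∧ t'.2.1 = e ∧
      (t.2.2, t'.2.2, (e + c.2.2.1) / 2, (t.2.1 + c.2.2.2) / 2) ∈ C

/-- Certificates of unreachability. -/
def IsInvariantCertificate (l : List ((Fin d → ℕ) × (Fin d → ℕ))) (x y : Fin d → ℕ)
    (Z : (List (ℕ × (Fin d → ℕ) × ℕ) × List ℕ × List (ℕ × ℕ × (Fin d → ℕ) × (Fin d → ℕ))) ×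
      ℕ × ℕ × ℕ) : Prop :=
  IsSimulation Z.1.1 Z.1.2.1 Z.1.2.2 ∧ Z.2.1 ∈ Z.1.2.1 ∧ ¬ Z.2.2.2 ∈ Z.1.2.1 ∧
    (Z.2.1, Z.2.2.1, 0, x) ∈ Z.1.2.2 ∧ (Z.2.2.1, Z.2.2.2, y, 0) ∈ Z.1.2.2 ∧
    ∀ p ∈ l, (Z.2.2.1, Z.2.2.1, p.1, p.2) ∈ Z.1.2.2

theorem primrecPred_isInvariantCertificate (l : List ((Fin d → ℕ) × (Fin d → ℕ))) :
    PrimrecPred fun s : ((Fin d → ℕ) × (Fin d → ℕ)) × _ =>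
      IsInvariantCertificate l s.1.1 s.1.2 s.2 := by
  unfold IsInvariantCertificate IsSimulation
  repeat' with_reducible first
    | exact Primrec.const _
    | exact primrec_self
    | exact Primrec.fst
    | exact Primrec.snd
    | apply PrimrecPred.and
    | apply PrimrecPred.not
    | apply primrecPred_forall_mem
    | apply primrecPred_exists_mem
    | apply primrecPred_imp
    | apply primrecPred_mem
    | apply primrecPred_eq
    | apply primrec_mod_two
    | apply primrec_add
    | apply primrec_div_two
    | apply primrec_fst
    | apply primrec_snd
    | apply Primrec.pair

theorem primrecPred_isReachCertificate (l : List ((Fin d → ℕ) × (Fin d → ℕ))) :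
    PrimrecPred fun s : ((Fin d → ℕ) × (Fin d → ℕ)) × List ((Fin d → ℕ) × ℕ) =>
      IsReachCertificate l s.1.1 s.1.2 s.2 := by
  unfold IsReachCertificate
  repeat' with_reducible first
    | exact Primrec.const _
    | exact primrec_self
    | exact Primrec.fst
    | exact Primrec.snd
    | apply PrimrecPred.and
    | apply PrimrecPred.or
    | apply primrecPred_forall_mem
    | apply primrecPred_exists_mem
    | apply primrecPred_lt
    | apply primrecPred_eq
    | apply primrec_add
    | apply primrec_fst
    | apply primrec_snd

theorem Accepts.exists_step {T : List (ℕ × (Fin d → ℕ) × ℕ)} {F : List ℕ} {q : ℕ} {u : Fin d → ℕ}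
    (hF : ∀ q ∈ F, ∃ t ∈ T, t.1 = q ∧ t.2.1 = 0 ∧ t.2.2 ∈ F) (h : Accepts T F q u) :
    ∃ e r u', (q, e, r) ∈ T ∧ Accepts T F r u' ∧ u = 2 • u' + e := by
  cases h with
  | zero hq =>
    obtain ⟨⟨q, e, r⟩, ht, rfl, he, hr⟩ := hF q hq
    exact ⟨e, r, 0, ht, .zero hr, by simpa using he.symm⟩
  | step he hu => exact ⟨_, _, _, he, hu, rfl⟩

theorem Accepts.mem_of_eq_zero {T : List (ℕ × (Fin d → ℕ) × ℕ)} {F : List ℕ} {q : ℕ}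
    {u : Fin d → ℕ} (hF : ∀ t ∈ T, t.2.1 = 0 → t.2.2 ∈ F → t.1 ∈ F) (h : Accepts T F q u)
    (hu : u = 0) : q ∈ F := by
  induction h with
  | zero hq => exact hq
  | @step q r e u he _ ih =>
    have h (i) : u i = 0 ∧ e i = 0 := by
      have := congrFun hu i
      simp only [Pi.add_apply, Pi.smul_apply, smul_eq_mul, Pi.zero_apply] at this
      omega
    exact hF _ he (funext fun i => (h i).2) (ih (funext fun i => (h i).1))

theorem IsSimulation.accepts {T : List (ℕ × (Fin d → ℕ) × ℕ)} {F : List ℕ}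
    {C : List (ℕ × ℕ × (Fin d → ℕ) × (Fin d → ℕ))} (hS : IsSimulation T F C) {q q' : ℕ}
    {m n u v : Fin d → ℕ} (hC : (q, q', m, n) ∈ C) (h : v + m = u + n) (hu : Accepts T F q u) :
    Accepts T F q' v := by
  obtain ⟨hF, hF', hCF, hCT⟩ := hS
  induction hk : ∑ i, (u i + v i) using Nat.strong_induction_on
    generalizing q q' m n u v with
  | _ k ih =>
    subst hk
    by_cases h₀ : u = 0 ∧ v = 0
    · obtain ⟨rfl, rfl⟩ := h₀
      exact .zero (hCF _ hC (hu.mem_of_eq_zero hF rfl) (by simpa using h))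
    obtain ⟨e, r, u, ht, hur, rfl⟩ := hu.exists_step hF'
    have hv : v = 2 • (fun i => v i / 2) + fun i => v i % 2 := by
      ext i
      simp only [Pi.add_apply, Pi.smul_apply, smul_eq_mul]
      omega
    obtain ⟨⟨q', e', r'⟩, ht', rfl, rfl, hC'⟩ := hCT _ hC _ ht rfl (fun i => v i % 2)
      (by
        simp only [Finset.mem_toList, Finset.mem_Iic]
        exact fun i => Nat.le_of_lt_succ (Nat.mod_lt _ two_pos))
      (by
        ext i
        have := congrFun h i
        simp only [Pi.add_apply, Pi.smul_apply, smul_eq_mul] at this ⊢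
        omega)
    rw [hv]
    refine .step ht' (ih _ ?_ hC' ?_ hur rfl)
    · refine Finset.sum_lt_sum (fun i _ => ?_) ?_
      · simp only [Pi.add_apply, Pi.smul_apply, smul_eq_mul]
        omega
      · by_contra! hle
        have h₁ (i) : (2 • u + e) i = 0 ∧ v i = 0 := by
          have := hle i (Finset.mem_univ i)
          simp only [Pi.add_apply, Pi.smul_apply, smul_eq_mul] at this ⊢
          omega
        exact h₀ ⟨funext fun i => (h₁ i).1, funext fun i => (h₁ i).2⟩
    · ext i
      have := congrFun h i
      simp only [Pi.add_apply, Pi.smul_apply, smul_eq_mul, Pi.div_apply, Pi.ofNat_apply] at this ⊢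
      omega

theorem exists_list_mem_iff {α : Type*} {s : Set α} (hs : s.Finite) :
    ∃ l : List α, ∀ a, a ∈ l ↔ a ∈ s :=
  ⟨hs.toFinset.toList, by simp⟩

/-- A semilinear inductive invariant yields a certificate of unreachability. -/
theorem exists_invariantCertificate (hl : ∀ u v, Step A u v ↔ ∃ p ∈ l, v + p.1 = u + p.2)
    {S : Set (Fin d → ℕ)} (hS : IsSemilinearSet S) (hx : x ∈ S) (hy : y ∉ S)
    (hinv : ∀ u ∈ S, ∀ v, Step A u v → v ∈ S) : ∃ Z, IsInvariantCertificate l x y Z := by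
  have h₀ := IsSemilinearSet.singleton (0 : Fin d → ℕ)
  obtain ⟨K, hK, ⟨hSK, h₀K, h₁K⟩, hq⟩ : ∃ K : Set (Set (Fin d → ℕ)), K.Finite ∧
      (S ∈ K ∧ {0} ∈ K ∧ {0}ᶜ ∈ K) ∧
      ∀ U ∈ K, ∀ e ≤ (1 : Fin d → ℕ), {u | 2 • u + e ∈ U} ∈ K := by
    obtain ⟨K, hK, hSK, hq⟩ := exists_finite_kernel hS
    obtain ⟨K', hK', hSK', hq'⟩ := exists_finite_kernel h₀
    obtain ⟨K'', hK'', hSK'', hq''⟩ := exists_finite_kernel h₀.compl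
    refine ⟨K ∪ K' ∪ K'', (hK.union hK').union hK'', ⟨.inl (.inl hSK), .inl (.inr hSK'),
      .inr hSK''⟩, ?_⟩
    rintro U ((hU | hU) | hU) e he
    · exact .inl (.inl (hq U hU e he))
    · exact .inl (.inr (hq' U hU e he))
    · exact .inr (hq'' U hU e he)
  obtain ⟨N, hN⟩ := Set.countable_iff_exists_injOn.1 hK.countable
  obtain ⟨b, hb⟩ := (List.finite_toSet
    (1 :: x :: y :: (l.map Prod.fst ++ l.map Prod.snd))).bddAbove
  have hb' (c) (hc : c ∈ 1 :: x :: y :: (l.map Prod.fst ++ l.map Prod.snd)) : c ≤ b := hb hc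
  simp only [List.mem_cons, List.mem_append] at hb'
  obtain ⟨T, hT⟩ := exists_list_mem_iff ((hK.prod (Set.finite_Iic (1 : Fin d → ℕ))).image
    fun p => (N p.1, p.2, N {u | 2 • u + p.2 ∈ p.1}))
  obtain ⟨F, hF⟩ := exists_list_mem_iff ((hK.subset (Set.sep_subset K (0 ∈ ·))).image N)
  obtain ⟨C, hC⟩ := exists_list_mem_iff (((hK.prod (hK.prod ((Set.finite_Iic b).prod
    (Set.finite_Iic b)))).subset (Set.sep_subset _ fun c =>
      ∀ u v, v + c.2.2.1 = u + c.2.2.2 → u ∈ c.1 → v ∈ c.2.1)).image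
    fun c => (N c.1, N c.2.1, c.2.2))
  have hFN {U} (hU : U ∈ K) : N U ∈ F ↔ 0 ∈ U := by
    rw [hF]
    constructor
    · rintro ⟨V, ⟨hV, h⟩, hVU⟩
      rwa [← hN hV hU hVU]
    · exact fun h => ⟨U, ⟨hU, h⟩, rfl⟩
  have hTN {U} (hU : U ∈ K) {e} (he : e ≤ 1) : (N U, e, N {u | 2 • u + e ∈ U}) ∈ T :=
    (hT _).2 ⟨(U, e), ⟨hU, he⟩, rfl⟩
  have hCN {U V m n} (hU : U ∈ K) (hV : V ∈ K) (hm : m ≤ b) (hn : n ≤ b)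
      (h : ∀ u v, v + m = u + n → u ∈ U → v ∈ V) : (N U, N V, m, n) ∈ C :=
    (hC _).2 ⟨(U, V, m, n), ⟨⟨hU, hV, hm, hn⟩, h⟩, rfl⟩
  have hb₀ : (0 : Fin d → ℕ) ≤ b := fun _ => Nat.zero_le _
  refine ⟨((T, F, C), N {0}, N S, N {0}ᶜ), ⟨?_, ?_, ?_, ?_⟩, ?_, ?_, ?_, ?_, ?_⟩
  · intro t ht
    obtain ⟨⟨U, e⟩, ⟨hU, he⟩, rfl⟩ := (hT t).1 ht
    dsimp only
    rintro rfl h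
    rw [hFN (hq U hU 0 he)] at h
    rw [hFN hU]
    simpa using h
  · intro q hqF
    obtain ⟨U, ⟨hU, h⟩, rfl⟩ := (hF q).1 hqF
    have he : (0 : Fin d → ℕ) ≤ 1 := fun _ => Nat.zero_le _
    refine ⟨_, hTN hU he, rfl, rfl, ?_⟩
    rw [hFN (hq U hU 0 he)]
    simpa using h
  · intro c hc
    obtain ⟨⟨U, V, m, n⟩, ⟨⟨hU, hV, -, -⟩, h⟩, rfl⟩ := (hC c).1 hc
    dsimp only
    rintro h₀ rfl
    rw [hFN hU] at h₀
    rw [hFN hV]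
    exact h 0 0 rfl h₀
  · intro c hc t ht
    obtain ⟨⟨U, V, m, n⟩, ⟨⟨hU, hV, hm, hn⟩, h⟩, rfl⟩ := (hC c).1 hc
    obtain ⟨⟨W, e⟩, ⟨hW, he⟩, rfl⟩ := (hT t).1 ht
    dsimp only at h ⊢
    intro hWU e' he' hpar
    obtain rfl := hN hW hU hWU
    rw [Finset.mem_toList, Finset.mem_Iic] at he'
    have hb₁ := hb' 1 (.inl rfl)
    refine ⟨_, hTN hV he', rfl, rfl, hCN (hq _ hU e he) (hq _ hV e' he') (fun i => ?_)
      (fun i => ?_) fun u v huv hu => h _ _ ?_ hu⟩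
    · have h₁ := he' i
      have h₂ := hm i
      have h₃ := hb₁ i
      simp only [Pi.add_apply, Pi.div_apply, Pi.ofNat_apply] at h₁ h₂ h₃ ⊢
      omega
    · have h₁ := he i
      have h₂ := hn i
      have h₃ := hb₁ i
      simp only [Pi.add_apply, Pi.div_apply, Pi.ofNat_apply] at h₁ h₂ h₃ ⊢
      omega
    · ext i
      have h₁ := congrFun huv i
      have h₂ := congrFun hpar i
      simp only [Pi.add_apply, Pi.smul_apply, smul_eq_mul, Pi.div_apply, Pi.ofNat_apply]
        at h₁ h₂ ⊢
      omega
  · exact (hFN h₀K).2 rfl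
  · exact fun h => (hFN h₁K).1 h rfl
  · refine hCN h₀K hSK hb₀ (hb' x (.inr (.inl rfl))) ?_
    rintro u v huv rfl
    simp only [add_zero, zero_add] at huv
    rwa [huv]
  · refine hCN hSK h₁K (hb' y (.inr (.inr (.inl rfl)))) hb₀ ?_
    rintro u v huv hu rfl
    simp only [add_zero, zero_add] at huv
    exact hy (huv ▸ hu)
  · intro p hp
    exact hCN hSK hSK
      (hb' _ (.inr (.inr (.inr (.inl (List.mem_map_of_mem hp))))))
      (hb' _ (.inr (.inr (.inr (.inr (List.mem_map_of_mem hp))))))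
      fun u v huv hu => hinv u hu v ((hl u v).2 ⟨p, hp, huv⟩)

theorem not_reach_iff_exists_certificate (hA : A.Finite)
    (hl : ∀ u v, Step A u v ↔ ∃ p ∈ l, v + p.1 = u + p.2) :
    ¬ Reach A x y ↔ ∃ Z, IsInvariantCertificate l x y Z := by
  constructor
  · intro h
    obtain ⟨S, hS, hx, hy, hinv⟩ := exists_semilinear_invariant hA h
    exact exists_invariantCertificate hl hS hx hy hinv
  · rintro ⟨⟨⟨T, F, C⟩, q₀, q, q₁⟩, hS, h₀, h₁, hx, hy, hinv⟩ h
    have hacc {v} (h : Reach A x v) : Accepts T F q v := by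
      induction h with
      | refl => exact hS.accepts hx (by simp) (.zero h₀)
      | tail _ huv ih =>
        obtain ⟨p, hp, h⟩ := (hl _ _).1 huv
        exact hS.accepts (hinv p hp) h ih
    exact h₁ ((hS.accepts (v := 0) hy (by simp) (hacc h)).mem_of_eq_zero hS.1 rfl)

end Invariant

theorem computablePred_reach {d : ℕ} {A : Set (Fin d → ℤ)} (hA : A.Finite) :
    ComputablePred fun p : (Fin d → ℕ) × (Fin d → ℕ) => Reach A p.1 p.2 := by
  obtain ⟨l, hl⟩ := exists_list_step_iff hA
  exact ComputablePred.computable_iff_re_compl_re'.2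
    ⟨(rePred_exists (primrecPred_isReachCertificate l)).of_eq fun _ =>
      (reach_iff_exists_certificate hl).symm,
    (rePred_exists (primrecPred_isInvariantCertificate l)).of_eq fun _ =>
      (not_reach_iff_exists_certificate hA hl).symm⟩

end VAS

theorem exists_isRun_iff_reach {d : ℕ} {A : Set (Act d)} {x y : Conf d} :
    (∃ w : List (Trip d), IsRun A (x, w, y)) ↔ VAS.Reach A x y := by
  constructor
  · rintro ⟨w, hw⟩
    induction w generalizing x with
    | nil =>
      obtain rfl : x = y := hw.2
      exact VAS.Reach.refl x
    | cons t w ih =>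
      obtain ⟨ht, rfl, hw⟩ := hw
      have htA := ht t List.mem_cons_self
      exact .head ⟨t.2.1, htA.1, htA.2⟩ (ih ⟨fun s hs => ht s (List.mem_cons_of_mem t hs), hw⟩)
  · intro h
    induction h using Relation.ReflTransGen.head_induction_on with
    | refl => exact ⟨[], by simp [IsRun, ChainFrom]⟩
    | @head u v huv _ ih =>
      obtain ⟨a, ha, huv⟩ := huv
      obtain ⟨w, hw, hwy⟩ := ih
      exact ⟨(u, a, v) :: w, List.forall_mem_cons.2 ⟨⟨ha, huv⟩, hw⟩, rfl, hwy⟩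

/-- VAS reachability is decidable: for every dimension `d` and finite set
`A ⊆ ℤ^d` of actions, the predicate on pairs `(x, y)` of configurations
holding iff there exists a run of the VAS `A` from `x` to `y` is computable. -/
theorem vas_reachability_decidable (d : ℕ) (A : Set (Act d)) (hA : A.Finite) :
    ComputablePred (fun p : Conf d × Conf d =>
      ∃ w : List (Trip d), IsRun A (p.1, w, p.2)) := by
  exact (VAS.computablePred_reach hA).of_eq fun _ => exists_isRun_iff_reach.symm
end
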